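/- Let A := sgn Q(0) + sgn Q(2π/3) + sgn Q(4π/3). For every ψ ∈ L²(ℝ) whose Wigner function W_ψ is integrable on ℝ², one has (1/2)⟨ψ, (A² − 3)ψ⟩ = ⟨ψ, ((sgn Q(0))∘(sgn Q(2π/3)) + (sgn Q(0))∘(sgn Q(4π/3)) + (sgn Q(2π/3))∘(sgn Q(4π/3)))ψ⟩ = ∬_{ℝ²} f(q,p) W_ψ(q,p) dq dp, where B ∘ C := (BC + CB)/2. In other words, f is the Weyl transform of the operator (A² − 3)/2. -/

import Mathlib

open MeasureTheory Complex Real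
open scoped InnerProductSpace ComplexConjugate

noncomputable section

/-- The complex Hilbert space `L²(ℝ, ℂ)`. -/
abbrev L2 : Type := Lp ℂ 2 (volume : Measure ℝ)

/-- `F` is the Fourier–Plancherel unitary operator on `L²(ℝ)`,
with convention `(Fψ)(p) = (2π)^{-1/2} ∫ e^{-ipq} ψ(q) dq`
(this property on the dense subspace `L¹ ∩ L²` determines `F` uniquely). -/
def IsFourier (F : L2 ≃ₗᵢ[ℂ] L2) : Prop :=
  ∀ ψ : L2, Integrable (⇑ψ) volume →
    (F ψ : ℝ → ℂ) =ᵐ[volume]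
      fun p : ℝ => (((2 * π) ^ (-(1:ℝ)/2) : ℝ) : ℂ) *
        ∫ q : ℝ, Complex.exp (-(Complex.I) * (p : ℂ) * (q : ℂ)) * ψ q

/-- `T` is the bounded multiplication operator `M_g` by `g` on `L²(ℝ)`. -/
def IsMulOp (g : ℝ → ℂ) (T : L2 →L[ℂ] L2) : Prop :=
  ∀ ψ : L2, (T ψ : ℝ → ℂ) =ᵐ[volume] fun q => g q * ψ q

/-- `T = sgn P := 𝓕⁻¹ ∘ M_sgn ∘ 𝓕`. -/
def IsSgnP (T : L2 →L[ℂ] L2) : Prop :=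
  ∃ F : L2 ≃ₗᵢ[ℂ] L2, IsFourier F ∧
    ∀ ψ : L2, (F (T ψ) : ℝ → ℂ) =ᵐ[volume]
      fun p => ((Real.sign p : ℝ) : ℂ) * (F ψ : ℝ → ℂ) p

/-- `χ_t(q) = exp(−(i/2)(cot t) q²)`. -/
def chi (t q : ℝ) : ℂ :=
  Complex.exp (-(Complex.I / 2) * ((Real.cos t / Real.sin t : ℝ) : ℂ) * (q : ℂ) ^ 2)

/-- `T = sgn Q(t)`: for `t = 0` this is `M_sgn`, and for `sin t ≠ 0` it is
`sgn(sin t) · M_{χ_t} ∘ (sgn P) ∘ M_{χ_t}⁻¹`, which realizes `sgn(Q cos t + P sin t)`. -/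
def IsSgnQ (t : ℝ) (T : L2 →L[ℂ] L2) : Prop :=
  if t = 0 then IsMulOp (fun q => ((Real.sign q : ℝ) : ℂ)) T
  else ∃ P Mc Mci : L2 →L[ℂ] L2, IsSgnP P ∧ IsMulOp (chi t) Mc ∧
    IsMulOp (fun q => (chi t q)⁻¹) Mci ∧
    T = (((Real.sign (Real.sin t) : ℝ) : ℂ) • (Mc ∘L P ∘L Mci))

/-- The Wigner function `W_ψ(q,p) = (1/(2π)) ∫ ψ(q + x/2) conj(ψ(q − x/2)) e^{ipx} dx`. -/
def Wig (ψ : ℝ → ℂ) (q p : ℝ) : ℂ :=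
  (1 / (2 * (π : ℂ))) *
    ∫ x : ℝ, ψ (q + x / 2) * conj (ψ (q - x / 2)) * Complex.exp (Complex.I * (p : ℂ) * (x : ℂ))

/-- The sine integral `Si(x) = ∫₀ˣ (sin u)/u du`. -/
def Si (x : ℝ) : ℝ := ∫ u in (0:ℝ)..x, Real.sin u / u

/-- The function `f(q,p)`, Weyl transform of `(A² − 3)/2`. -/
def ftrans (q p : ℝ) : ℝ :=
  (2 / π) * (Si ((4 / Real.sqrt 3) * q * ((-q + p * Real.sqrt 3) / 2))
    + Si ((4 / Real.sqrt 3) * q * ((-q - p * Real.sqrt 3) / 2))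
    + Si ((4 / Real.sqrt 3) * ((-q + p * Real.sqrt 3) / 2) * ((-q - p * Real.sqrt 3) / 2)))

section

open Filter Topology Set

lemma Si_eq_sinc (x : ℝ) : Si x = ∫ u in (0:ℝ)..x, Real.sinc u := by
  unfold Si
  apply intervalIntegral.integral_congr_ae
  have : ∀ᵐ u : ℝ, u ≠ 0 := by simp [ae_iff]
  filter_upwards [this] with u hu _
  rw [Real.sinc_of_ne_zero hu]

lemma Si_neg (x : ℝ) : Si (-x) = - Si x := by
  have h := intervalIntegral.integral_comp_neg (a := 0) (b := x) Real.sinc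
  rw [Si_eq_sinc, Si_eq_sinc, intervalIntegral.integral_symm, ← neg_zero, ← h]
  simp [Real.sinc_neg]

lemma continuous_Si : Continuous Si := by
  rw [funext Si_eq_sinc]
  exact intervalIntegral.continuous_primitive
    (fun a b => Real.continuous_sinc.intervalIntegrable a b) 0

lemma integral_sin_mul_div (p a b : ℝ) :
    ∫ s in a..b, Real.sin (p * s) / s = Si (p * b) - Si (p * a) := by
  rcases eq_or_ne p 0 with rfl | hp
  · simp
  have h1 : ∀ s : ℝ, Real.sin (p * s) / s = p * (Real.sin (p * s) / (p * s)) := fun s => by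
    rcases eq_or_ne s 0 with rfl | hs
    · simp
    · field_simp
  have hint : ∀ c d : ℝ, IntervalIntegrable (fun u => Real.sin u / u) volume c d := fun c d => by
    refine (Real.continuous_sinc.intervalIntegrable c d).congr_ae ?_
    have : ∀ᵐ u : ℝ, u ≠ 0 := by simp [ae_iff]
    filter_upwards [ae_restrict_of_ae this] with u hu
    rw [Real.sinc_of_ne_zero hu]
  simp_rw [h1]
  rw [intervalIntegral.integral_const_mul,
    intervalIntegral.integral_comp_mul_left (fun u => Real.sin u / u) hp, smul_eq_mul,
    mul_inv_cancel_left₀ hp]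
  exact (intervalIntegral.integral_interval_sub_left (hint _ _) (hint _ _)).symm

lemma integral_exp_neg_mul_sin (x l : ℝ) :
    ∫ u in (0:ℝ)..x, Real.exp (-(l * u)) * Real.sin u =
      (1 - Real.exp (-(l * x)) * (Real.cos x + l * Real.sin x)) / (1 + l ^ 2) := by
  have hpos : (1 + l ^ 2) ≠ 0 := by positivity
  have hd : ∀ u : ℝ, HasDerivAt
      (fun u => -(Real.exp (-(l * u)) * (Real.cos u + l * Real.sin u)) / (1 + l ^ 2))
      (Real.exp (-(l * u)) * Real.sin u) u := fun u => by
    have h1 : HasDerivAt (fun u : ℝ => Real.exp (-(l * u))) (Real.exp (-(l * u)) * -(l * 1)) u :=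
      ((hasDerivAt_id u).const_mul l).neg.exp
    have h2 := (Real.hasDerivAt_cos u).add ((Real.hasDerivAt_sin u).const_mul l)
    refine ((h1.mul h2).neg.div_const (1 + l ^ 2)).congr_deriv ?_
    simp only [Pi.add_apply]
    field_simp
    ring
  rw [intervalIntegral.integral_eq_sub_of_hasDerivAt (fun u _ => hd u)
    (Continuous.intervalIntegrable (by fun_prop) _ _)]
  simp
  ring

lemma integral_Ioi_exp_neg_mul {u : ℝ} (hu : 0 < u) :
    ∫ l in Ioi (0:ℝ), Real.exp (-(l * u)) = u⁻¹ := by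
  have := integral_exp_mul_Ioi (a := -u) (by linarith) 0
  simp only [mul_zero, Real.exp_zero] at this
  rw [show u⁻¹ = -1 / -u by field_simp, ← this]
  congr 1; ext l; ring_nf

lemma integrableOn_Ioi_exp_neg_mul {u : ℝ} (hu : 0 < u) :
    IntegrableOn (fun l => Real.exp (-(l * u))) (Ioi 0) := by
  have := integrableOn_exp_mul_Ioi (a := -u) (by linarith) 0
  refine this.congr_fun (fun l _ => ?_) measurableSet_Ioi
  ring_nf

lemma Si_eq_integral {x : ℝ} (hx : 0 ≤ x) :
    Si x = ∫ l in Ioi (0:ℝ),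
      (1 - Real.exp (-(l * x)) * (Real.cos x + l * Real.sin x)) / (1 + l ^ 2) := by
  have h1 : Si x = ∫ u in Ioc 0 x, ∫ l in Ioi (0:ℝ), Real.exp (-(l * u)) * Real.sin u := by
    rw [Si, intervalIntegral.integral_of_le hx]
    refine setIntegral_congr_fun measurableSet_Ioc fun u hu => ?_
    rw [integral_mul_const, integral_Ioi_exp_neg_mul hu.1]
    ring
  rw [h1, integral_integral_swap]
  · refine setIntegral_congr_fun measurableSet_Ioi fun l _ => ?_
    rw [← intervalIntegral.integral_of_le hx, integral_exp_neg_mul_sin]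
  · rw [integrable_prod_iff (Continuous.aestronglyMeasurable (by fun_prop))]
    refine ⟨?_, ?_⟩
    · filter_upwards [ae_restrict_mem measurableSet_Ioc] with u hu
      exact (integrableOn_Ioi_exp_neg_mul hu.1).mul_const (Real.sin u)
    · have : IntegrableOn (fun u => |Real.sinc u|) (Ioc 0 x) :=
        (Real.continuous_sinc.abs.integrableOn_Icc).mono_set Ioc_subset_Icc_self
      refine this.congr_fun (fun u hu => ?_) measurableSet_Ioc
      simp only [Function.uncurry, norm_mul, Real.norm_eq_abs, Real.abs_exp]
      rw [integral_mul_const, integral_Ioi_exp_neg_mul hu.1, Real.sinc_of_ne_zero hu.1.ne', abs_div,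
        abs_of_pos hu.1]
      ring

lemma abs_Si_integrand_le {x l : ℝ} (hx : 0 ≤ x) (hl : 0 < l) :
    ‖(1 - Real.exp (-(l * x)) * (Real.cos x + l * Real.sin x)) / (1 + l ^ 2)‖ ≤
      3 * (1 + l ^ 2)⁻¹ := by
  have hlx : 0 ≤ l * x := by positivity
  have h1 : Real.exp (-(l * x)) ≤ 1 := Real.exp_le_one_iff.2 (by linarith)
  have h2 : l * x * Real.exp (-(l * x)) ≤ 1 := by
    rw [Real.exp_neg, ← div_eq_mul_inv, div_le_one (Real.exp_pos _)]
    linarith [Real.add_one_le_exp (l * x)]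
  have h3 : |Real.sin x| ≤ x := by
    rw [← abs_of_nonneg hx]; simpa [abs_of_nonneg hx] using Real.abs_sin_le_abs (x := x)
  rw [norm_div, Real.norm_eq_abs, Real.norm_eq_abs, abs_of_pos (by positivity : 0 < 1 + l ^ 2),
    div_eq_mul_inv]
  gcongr
  have h4 : |Real.exp (-(l * x)) * Real.cos x| ≤ 1 := by
    rw [abs_mul, Real.abs_exp]
    exact mul_le_one₀ h1 (abs_nonneg _) (Real.abs_cos_le_one x)
  have h5 : |Real.exp (-(l * x)) * (l * Real.sin x)| ≤ 1 := by
    rw [abs_mul, Real.abs_exp, abs_mul, abs_of_pos hl]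
    calc _ ≤ Real.exp (-(l * x)) * (l * x) := by gcongr
      _ ≤ 1 := by linarith
  rw [mul_add]
  rw [abs_le] at *
  constructor <;> linarith [h4.1, h4.2, h5.1, h5.2]

lemma tendsto_Si_atTop : Tendsto Si atTop (𝓝 (π / 2)) := by
  have hlim : Tendsto (fun x : ℝ => ∫ l in Ioi (0:ℝ),
      (1 - Real.exp (-(l * x)) * (Real.cos x + l * Real.sin x)) / (1 + l ^ 2)) atTop
      (𝓝 (∫ l in Ioi (0:ℝ), (1 + l ^ 2)⁻¹)) := by
    refine tendsto_integral_filter_of_dominated_convergence (fun l => 3 * (1 + l ^ 2)⁻¹) ?_ ?_ ?_ ?_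
    · exact Eventually.of_forall fun x => (Measurable.aestronglyMeasurable (by fun_prop))
    · filter_upwards [eventually_ge_atTop 0] with x hx
      filter_upwards [ae_restrict_mem measurableSet_Ioi] with l hl
      exact abs_Si_integrand_le hx hl
    · exact (integrable_inv_one_add_sq.const_mul 3).integrableOn
    · filter_upwards [ae_restrict_mem measurableSet_Ioi] with l hl
      have h0 : Tendsto (fun x : ℝ => Real.exp (-(l * x))) atTop (𝓝 0) :=
        Real.tendsto_exp_neg_atTop_nhds_zero.comp (tendsto_id.const_mul_atTop hl)
      have h1 : Tendsto (fun x : ℝ => Real.exp (-(l * x)) * (Real.cos x + l * Real.sin x)) atTop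
          (𝓝 0) := by
        refine h0.zero_mul_isBoundedUnder_le ⟨1 + l, ?_⟩
        refine eventually_map.2 (Eventually.of_forall fun x => ?_)
        refine (norm_add_le _ _).trans ?_
        have hl' : 0 < l := hl
        rw [norm_mul, Real.norm_eq_abs, Real.norm_eq_abs, Real.norm_eq_abs, abs_of_pos hl']
        have := mul_le_mul_of_nonneg_left (Real.abs_sin_le_one x) hl'.le
        linarith [Real.abs_cos_le_one x]
      simpa using (h1.const_sub 1).div_const (1 + l ^ 2)
  rw [integral_Ioi_inv_one_add_sq, Real.arctan_zero, sub_zero] at hlim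
  refine hlim.congr' ?_
  filter_upwards [eventually_ge_atTop 0] with x hx
  rw [Si_eq_integral hx]

lemma abs_Si_le (x : ℝ) : |Si x| ≤ 3 * π / 2 := by
  wlog hx : 0 ≤ x generalizing x
  · simpa [Si_neg] using this (-x) (by linarith)
  rw [Si_eq_integral hx, ← Real.norm_eq_abs]
  refine (norm_integral_le_of_norm_le (g := fun l : ℝ => 3 * (1 + l ^ 2)⁻¹)
    (integrable_inv_one_add_sq.const_mul 3).integrableOn ?_).trans (le_of_eq ?_)
  · filter_upwards [ae_restrict_mem measurableSet_Ioi] with l hl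
    exact abs_Si_integrand_le hx hl
  · rw [integral_const_mul, integral_Ioi_inv_one_add_sq, Real.arctan_zero]
    ring

lemma mulL2_memLp {g : ℝ → ℂ} (hg : Measurable g) (hb : ∀ x, ‖g x‖ ≤ 1) (ψ : L2) :
    MemLp (fun q => g q * ψ q) 2 volume :=
  (Lp.memLp ψ).of_le (hg.aestronglyMeasurable.mul (Lp.aestronglyMeasurable ψ))
    (Eventually.of_forall fun x => by
      rw [norm_mul]; exact mul_le_of_le_one_left (norm_nonneg _) (hb x))

/-- Multiplication by a measurable function bounded by `1`, as an operator on `L²(ℝ)`. -/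
def mulL2 (g : ℝ → ℂ) (hg : Measurable g) (hb : ∀ x, ‖g x‖ ≤ 1) : L2 →L[ℂ] L2 :=
  LinearMap.mkContinuous
    { toFun := fun ψ => (mulL2_memLp hg hb ψ).toLp _
      map_add' := fun ψ φ => by
        rw [← MemLp.toLp_add, MemLp.toLp_eq_toLp_iff]
        filter_upwards [Lp.coeFn_add ψ φ] with x hx
        rw [hx]
        exact mul_add _ _ _
      map_smul' := fun c ψ => by
        rw [← MemLp.toLp_const_smul, MemLp.toLp_eq_toLp_iff]
        filter_upwards [Lp.coeFn_smul c ψ] with x hx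
        simp [hx, mul_left_comm] } 1 fun ψ => by
    rw [one_mul]
    refine Lp.norm_le_norm_of_ae_le ?_
    filter_upwards [(mulL2_memLp hg hb ψ).coeFn_toLp] with x hx
    simp only [LinearMap.coe_mk, AddHom.coe_mk, hx, norm_mul]
    exact mul_le_of_le_one_left (norm_nonneg _) (hb x)

lemma isMulOp_mulL2 {g : ℝ → ℂ} (hg : Measurable g) (hb : ∀ x, ‖g x‖ ≤ 1) :
    IsMulOp g (mulL2 g hg hb) := fun ψ => (mulL2_memLp hg hb ψ).coeFn_toLp

/-- Composition with a measure preserving map, as an operator on `L²(ℝ)`. -/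
def compL2 (f : ℝ → ℝ) (hf : MeasurePreserving f) : L2 →L[ℂ] L2 :=
  (Lp.compMeasurePreservingₗᵢ ℂ f hf).toContinuousLinearMap

lemma coeFn_compL2 {f : ℝ → ℝ} (hf : MeasurePreserving f) (ψ : L2) :
    (compL2 f hf ψ : ℝ → ℂ) =ᵐ[volume] fun x => ψ (f x) :=
  Lp.coeFn_compMeasurePreserving ψ hf

lemma L2_inner_eq (u v : L2) : ⟪u, v⟫_ℂ = ∫ x, conj (u x) * v x := by
  rw [L2.inner_def]
  congr 1; ext x
  rw [RCLike.inner_apply, mul_comm]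

lemma L2_integrable_inner (u v : L2) : Integrable (fun x => conj (u x) * v x) := by
  refine (L2.integrable_inner u v).congr (Eventually.of_forall fun x => ?_)
  exact mul_comm _ _

lemma dense_integrable : Dense {ψ : L2 | Integrable (⇑ψ) volume} := by
  have h := Lp.simpleFunc.denseRange (E := ℂ) (μ := (volume : Measure ℝ)) (p := 2) (by simp)
  refine h.mono ?_
  rintro _ ⟨f, rfl⟩
  have h1 : Integrable (Lp.simpleFunc.toSimpleFunc f) volume :=
    (SimpleFunc.memLp_iff_integrable (by simp) (by simp)).1 (Lp.simpleFunc.memLp f)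
  exact h1.congr (Lp.simpleFunc.toSimpleFunc_eq_toFun f)

lemma continuous_eq_of_integrable {E : Type*} [TopologicalSpace E] [T2Space E] {A B : L2 → E}
    (hA : Continuous A) (hB : Continuous B) (h : ∀ ψ : L2, Integrable (⇑ψ) volume → A ψ = B ψ)
    (ψ : L2) : A ψ = B ψ :=
  congrFun (hA.ext_on dense_integrable hB h) ψ

lemma exists_seq_integrable (ψ : L2) :
    ∃ u : ℕ → L2, (∀ n, Integrable (⇑(u n)) volume) ∧ Tendsto u atTop (𝓝 ψ) :=
  mem_closure_iff_seq_limit.1 (dense_integrable ψ)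

lemma exists_subseq_tendsto_ae {u : ℕ → L2} {ψ : L2} (h : Tendsto u atTop (𝓝 ψ)) :
    ∃ ns : ℕ → ℕ, StrictMono ns ∧
      ∀ᵐ x : ℝ, Tendsto (fun i => u (ns i) x) atTop (𝓝 (ψ x)) :=
  (tendstoInMeasure_of_tendsto_Lp h).exists_seq_tendsto_ae

/-- An almost everywhere formula for a bounded operator extends from a sequence to its limit. -/
lemma ae_eq_of_tendsto {u v : ℕ → L2} {ψ φ : L2} (hu : Tendsto u atTop (𝓝 ψ))
    (hv : Tendsto v atTop (𝓝 φ)) {w : ℝ → ℂ} {τ : ℝ → ℝ}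
    (hτ : Measure.QuasiMeasurePreserving τ volume volume)
    (h : ∀ n, (v n : ℝ → ℂ) =ᵐ[volume] fun x => w x * u n (τ x)) :
    (φ : ℝ → ℂ) =ᵐ[volume] fun x => w x * ψ (τ x) := by
  obtain ⟨ns, hns, h1⟩ := exists_subseq_tendsto_ae hu
  obtain ⟨ms, hms, h2⟩ := exists_subseq_tendsto_ae (hv.comp hns.tendsto_atTop)
  filter_upwards [hτ.ae h1, h2, ae_all_iff.2 h] with x hx1 hx2 hx
  refine tendsto_nhds_unique hx2 ?_
  have := (hx1.comp hms.tendsto_atTop).const_mul (w x)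
  refine this.congr fun i => ?_
  simp [hx]

lemma IsFourier.unique {F G : L2 ≃ₗᵢ[ℂ] L2} (hF : IsFourier F) (hG : IsFourier G) : F = G := by
  ext1 ψ
  refine continuous_eq_of_integrable F.continuous G.continuous (fun ψ h => ?_) ψ
  exact Lp.ext ((hF ψ h).trans (hG ψ h).symm)

lemma IsMulOp.unique {g : ℝ → ℂ} {A B : L2 →L[ℂ] L2} (hA : IsMulOp g A) (hB : IsMulOp g B) :
    A = B := by
  ext1 ψ
  exact Lp.ext ((hA ψ).trans (hB ψ).symm)

lemma IsMulOp.congr {g h : ℝ → ℂ} {A : L2 →L[ℂ] L2} (hA : IsMulOp g A) (hg : g = h) :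
    IsMulOp h A := hg ▸ hA

lemma IsMulOp.inner_left {g : ℝ → ℂ} {A B : L2 →L[ℂ] L2} (hA : IsMulOp g A)
    (hB : IsMulOp (fun x => conj (g x)) B) (u v : L2) : ⟪A u, v⟫_ℂ = ⟪u, B v⟫_ℂ := by
  rw [L2_inner_eq, L2_inner_eq]
  refine integral_congr_ae ?_
  filter_upwards [hA u, hB v] with x h1 h2
  rw [h1, h2, map_mul]
  ring

lemma norm_cexp_I_mul_ofReal (x : ℝ) : ‖Complex.exp (Complex.I * (x : ℂ))‖ = 1 := by
  rw [mul_comm, Complex.norm_exp_ofReal_mul_I]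

/-- Multiplication by `exp (i θ(x))`. -/
def phaseL2 (θ : ℝ → ℝ) (hθ : Measurable θ) : L2 →L[ℂ] L2 :=
  mulL2 (fun x => Complex.exp (Complex.I * (θ x : ℂ))) (by fun_prop)
    fun x => (norm_cexp_I_mul_ofReal _).le

lemma coeFn_phaseL2 {θ : ℝ → ℝ} (hθ : Measurable θ) (ψ : L2) :
    (phaseL2 θ hθ ψ : ℝ → ℂ) =ᵐ[volume] fun x => Complex.exp (Complex.I * (θ x : ℂ)) * ψ x :=
  isMulOp_mulL2 _ _ ψ

lemma integrable_phaseL2 {θ : ℝ → ℝ} (hθ : Measurable θ) {ψ : L2}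
    (h : Integrable (⇑ψ) volume) : Integrable (⇑(phaseL2 θ hθ ψ)) volume := by
  refine h.mono (Lp.aestronglyMeasurable _) ?_
  filter_upwards [coeFn_phaseL2 hθ ψ] with x hx
  rw [hx, norm_mul, norm_cexp_I_mul_ofReal, one_mul]

lemma integrable_compL2 {f : ℝ → ℝ} (hf : MeasurePreserving f) {ψ : L2}
    (h : Integrable (⇑ψ) volume) : Integrable (⇑(compL2 f hf ψ)) volume :=
  (hf.integrable_comp_of_integrable h).congr (coeFn_compL2 hf ψ).symm

lemma measurePreserving_const_sub (a : ℝ) :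
    MeasurePreserving (fun x : ℝ => a - x) volume volume :=
  volume.measurePreserving_sub_left a

/-- The translation `ψ ↦ ψ(· + s)`. -/
def translL2 (s : ℝ) : L2 →L[ℂ] L2 :=
  compL2 (fun x => x + s) (measurePreserving_add_right volume s)

lemma IsFourier.map_translL2 {F : L2 ≃ₗᵢ[ℂ] L2} (hF : IsFourier F) (s : ℝ) (ψ : L2) :
    F (translL2 s ψ) = phaseL2 (fun p => s * p) (by fun_prop) (F ψ) := by
  refine continuous_eq_of_integrable (F.continuous.comp (translL2 s).continuous)
    ((phaseL2 _ _).continuous.comp F.continuous) (fun ψ h => ?_) ψ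
  have hs := measurePreserving_add_right (volume : Measure ℝ) s
  refine Lp.ext ((hF _ (integrable_compL2 hs h)).trans ?_)
  filter_upwards [coeFn_phaseL2 (θ := fun p => s * p) (by fun_prop) (F ψ), hF ψ h] with p h1 h2
  rw [Function.comp_apply, h1, h2, integral_congr_ae (g := fun q : ℝ => Complex.exp (-Complex.I * p * q) * ψ (q + s))]
  · rw [mul_left_comm, ← integral_const_mul (Complex.exp _),
      ← integral_add_right_eq_self (fun q : ℝ => _ * (Complex.exp (-Complex.I * p * q) * ψ q)) s]
    congr 2
    ext q
    rw [← mul_assoc, ← Complex.exp_add]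
    congr 2
    push_cast
    ring
  · filter_upwards [coeFn_compL2 hs ψ] with q hq
    rw [hq]

/-- The displaced parity operator `(Πψ)(z) = exp (2ip(q - z)) ψ(2q - z)`. -/
def parityL2 (q p : ℝ) : L2 →L[ℂ] L2 :=
  phaseL2 (fun z => 2 * p * (q - z)) (by fun_prop) ∘L
    compL2 (fun z => 2 * q - z) (measurePreserving_const_sub _)

lemma coeFn_parityL2 (q p : ℝ) (ψ : L2) :
    (parityL2 q p ψ : ℝ → ℂ) =ᵐ[volume]
      fun z => Complex.exp (Complex.I * (2 * p * (q - z) : ℝ)) * ψ (2 * q - z) := by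
  filter_upwards [coeFn_phaseL2 (θ := fun z => 2 * p * (q - z)) (by fun_prop)
    (compL2 (fun z => 2 * q - z) (measurePreserving_const_sub _) ψ),
    coeFn_compL2 (measurePreserving_const_sub (2 * q)) ψ] with z h1 h2
  rw [← h2, ← h1]
  rfl

lemma IsFourier.map_parityL2 {F : L2 ≃ₗᵢ[ℂ] L2} (hF : IsFourier F) (q p : ℝ) (ψ : L2) :
    F (parityL2 q p ψ) = parityL2 (-p) q (F ψ) := by
  refine continuous_eq_of_integrable (F.continuous.comp (parityL2 q p).continuous)
    ((parityL2 (-p) q).continuous.comp F.continuous) (fun ψ h => ?_) ψ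
  refine Lp.ext ((hF _ (integrable_phaseL2 (by fun_prop)
    (integrable_compL2 (measurePreserving_const_sub _) h))).trans ?_)
  filter_upwards [coeFn_parityL2 (-p) q (F ψ),
    (measurePreserving_const_sub (2 * -p)).quasiMeasurePreserving.ae (hF ψ h)] with k h1 h2
  rw [Function.comp_apply, h1, h2, integral_congr_ae (g := fun z : ℝ => Complex.exp (-Complex.I * k * z) *
    (Complex.exp (Complex.I * (2 * p * (q - z) : ℝ)) * ψ (2 * q - z)))]
  · rw [mul_left_comm, ← integral_const_mul (Complex.exp _), ← integral_sub_left_eq_self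
      (fun u : ℝ => _ * (Complex.exp (-Complex.I * (2 * -p - k : ℝ) * u) * ψ u)) volume (2 * q)]
    congr 2
    ext z
    rw [← mul_assoc, ← mul_assoc, ← Complex.exp_add, ← Complex.exp_add]
    congr 2
    push_cast
    ring
  · filter_upwards [coeFn_parityL2 q p ψ] with z hz
    exact congrArg _ hz

lemma IsFourier.symm_eq {F : L2 ≃ₗᵢ[ℂ] L2} (hF : IsFourier F) (φ : L2) :
    F.symm φ = compL2 (fun x => -x) (Measure.measurePreserving_neg volume) (F φ) := by
  refine continuous_eq_of_integrable F.symm.continuous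
    ((compL2 _ _).continuous.comp F.continuous) (fun φ hφ => ?_) φ
  refine ext_inner_left ℂ fun u => ?_
  refine continuous_eq_of_integrable (A := fun u => ⟪u, F.symm φ⟫_ℂ)
    (B := fun u => ⟪u, compL2 _ _ (F φ)⟫_ℂ) (by fun_prop) (by fun_prop) (fun u hu => ?_) u
  have h0 : ⟪u, F.symm φ⟫_ℂ = ⟪F u, φ⟫_ℂ := by
    rw [← F.inner_map_map, F.apply_symm_apply]
  rw [h0, L2_inner_eq, L2_inner_eq]
  set c : ℝ := (2 * π) ^ (-(1:ℝ)/2)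
  have h1 : ∫ x, conj (F u x) * φ x =
      ∫ p : ℝ, ∫ q : ℝ, c * (Complex.exp (Complex.I * p * q) * (conj (u q) * φ p)) := by
    refine integral_congr_ae ?_
    filter_upwards [hF u hu] with p hp
    rw [hp, map_mul, Complex.conj_ofReal, ← integral_conj, mul_assoc, ← integral_mul_const,
      ← integral_const_mul]
    congr 1
    ext q
    rw [map_mul, ← Complex.exp_conj]
    simp only [map_mul, map_neg, Complex.conj_I, Complex.conj_ofReal, neg_neg]
    ring
  have h2 : ∫ x, conj (u x) * compL2 (fun x => -x) (Measure.measurePreserving_neg volume) (F φ) x =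
      ∫ q : ℝ, ∫ p : ℝ, c * (Complex.exp (Complex.I * p * q) * (conj (u q) * φ p)) := by
    refine integral_congr_ae ?_
    filter_upwards [coeFn_compL2 (Measure.measurePreserving_neg volume) (F φ),
      (Measure.measurePreserving_neg (volume : Measure ℝ)).quasiMeasurePreserving.ae (hF φ hφ)]
      with q hq hq'
    rw [hq, hq', mul_left_comm, ← integral_const_mul, ← integral_const_mul]
    congr 1
    ext p
    rw [mul_left_comm (conj (u q))]
    congr 3
    push_cast
    ring
  rw [h1, h2]
  refine integral_integral_swap ?_
  have hprod : Integrable (fun z : ℝ × ℝ => φ z.1 * conj (u z.2)) (volume.prod volume) :=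
    hφ.mul_prod (Complex.conjCLE.toContinuousLinearMap.integrable_comp hu)
  refine (hprod.bdd_mul (f := fun z : ℝ × ℝ => c * Complex.exp (Complex.I * z.1 * z.2)) (c := |c|)
    (Continuous.aestronglyMeasurable (by fun_prop)) (Eventually.of_forall fun z => ?_)).congr
    (Eventually.of_forall fun z => ?_)
  · have := norm_cexp_I_mul_ofReal (z.1 * z.2)
    rw [Complex.ofReal_mul, ← mul_assoc] at this
    rw [norm_mul, this, mul_one, Complex.norm_real, Real.norm_eq_abs]
  · simp only [Function.uncurry]
    ring

lemma IsFourier.symm_apply_ae {F : L2 ≃ₗᵢ[ℂ] L2} (hF : IsFourier F) {φ : L2}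
    (hφ : Integrable (⇑φ) volume) :
    (F.symm φ : ℝ → ℂ) =ᵐ[volume] fun q : ℝ => (((2 * π) ^ (-(1:ℝ)/2) : ℝ) : ℂ) *
        ∫ p : ℝ, Complex.exp (Complex.I * q * p) * φ p := by
  rw [hF.symm_eq]
  filter_upwards [coeFn_compL2 (Measure.measurePreserving_neg volume) (F φ),
      (Measure.measurePreserving_neg (volume : Measure ℝ)).quasiMeasurePreserving.ae (hF φ hφ)]
      with q hq hq'
  rw [hq, hq']
  simp

lemma L2_integrable_norm_sq (v : L2) : Integrable (fun x => ‖v x‖ ^ 2) :=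
  (memLp_two_iff_integrable_sq_norm (Lp.aestronglyMeasurable v)).1 (Lp.memLp v)

/-- Strong convergence of multiplication operators under bounded pointwise convergence. -/
lemma tendsto_mulOp {g : ℕ → ℝ → ℂ} {g₀ : ℝ → ℂ} {A : ℕ → L2 →L[ℂ] L2} {B : L2 →L[ℂ] L2}
    (hA : ∀ n, IsMulOp (g n) (A n)) (hB : IsMulOp g₀ B) (hgm : ∀ n, Measurable (g n))
    (hg₀m : Measurable g₀) (hg : ∀ n x, ‖g n x‖ ≤ 1) (hg₀ : ∀ x, ‖g₀ x‖ ≤ 1)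
    (hlim : ∀ x, Tendsto (fun n => g n x) atTop (𝓝 (g₀ x))) (v : L2) :
    Tendsto (fun n => A n v) atTop (𝓝 (B v)) := by
  rw [tendsto_iff_norm_sub_tendsto_zero]
  have h1 : ∀ n, ⟪A n v - B v, A n v - B v⟫_ℂ =
      ∫ x, conj ((g n x - g₀ x) * v x) * ((g n x - g₀ x) * v x) := fun n => by
    rw [L2_inner_eq]
    refine integral_congr_ae ?_
    filter_upwards [hA n v, hB v, Lp.coeFn_sub (A n v) (B v)] with x h1 h2 h3
    rw [h3, Pi.sub_apply, h1, h2, sub_mul]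
  have h2 : Tendsto (fun n => ∫ x, conj ((g n x - g₀ x) * v x) * ((g n x - g₀ x) * v x)) atTop
      (𝓝 (∫ _ : ℝ, (0:ℂ))) := by
    refine tendsto_integral_of_dominated_convergence (fun x => 4 * ‖v x‖ ^ 2) (fun n => ?_)
      ((L2_integrable_norm_sq v).const_mul 4) (fun n => Eventually.of_forall fun x => ?_)
      (Eventually.of_forall fun x => ?_)
    · have : AEStronglyMeasurable (fun x => (g n x - g₀ x) * v x) volume :=
        ((hgm n).sub hg₀m).aestronglyMeasurable.mul (Lp.aestronglyMeasurable v)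
      exact (Complex.continuous_conj.comp_aestronglyMeasurable this).mul this
    · rw [norm_mul, RCLike.norm_conj, norm_mul]
      have : ‖g n x - g₀ x‖ ≤ 2 := (norm_sub_le _ _).trans (by linarith [hg n x, hg₀ x])
      calc _ ≤ (2 * ‖v x‖) * (2 * ‖v x‖) := by gcongr
        _ = _ := by ring
    · have h := ((hlim x).sub_const (g₀ x)).mul_const (v x)
      have := (((Complex.continuous_conj.tendsto _).comp h)).mul h
      simpa using this
  rw [integral_zero] at h2
  have h3 : Tendsto (fun n => ‖A n v - B v‖ ^ 2) atTop (𝓝 0) := by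
    have := (h2.congr fun n => (h1 n).symm).norm
    simp_rw [inner_self_eq_norm_sq_to_K] at this
    simpa using this
  simpa using h3.sqrt

lemma exp_neg_sq_div_mul {a : ℝ} (ha : a ≠ 0) (p k : ℝ) :
    Complex.exp (-((k - p : ℝ) : ℂ) ^ 2 / (4 * -(Complex.I * a))) *
        Complex.exp (Complex.I * (k ^ 2 / (4 * a) : ℝ)) =
      conj (Complex.exp (Complex.I * (p ^ 2 / (4 * a) : ℝ))) *
        Complex.exp (-Complex.I * (-p / (2 * a) : ℝ) * k) := by
  rw [← Complex.exp_conj, ← Complex.exp_add, ← Complex.exp_add]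
  congr 1
  have ha' : (a : ℂ) ≠ 0 := by exact_mod_cast ha
  simp only [map_mul, Complex.conj_I, Complex.conj_ofReal]
  push_cast
  have h : -((k : ℂ) - p) ^ 2 / (4 * -(Complex.I * a)) =
      -(Complex.I * (k - p) ^ 2 / (4 * a)) := by
    field_simp
    rw [Complex.I_sq]
    ring
  rw [h]
  field_simp
  ring

/-- The regularised chirp `exp (-(ε - ia)x²)`, with `ε = 1/(n+1)`. -/
def chirpApprox (a : ℝ) (n : ℕ) (x : ℝ) : ℂ :=
  Complex.exp (-((1 / ((n : ℝ) + 1) : ℝ) - Complex.I * a) * x ^ 2)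

lemma chirpApprox_re_pos (a : ℝ) (n : ℕ) :
    0 < (((1 / ((n : ℝ) + 1) : ℝ) : ℂ) - Complex.I * a).re := by
  simp only [Complex.sub_re, Complex.ofReal_re, Complex.mul_re, Complex.I_re, Complex.I_im,
    Complex.ofReal_im, zero_mul, mul_zero, sub_zero]
  positivity

lemma continuous_chirpApprox (a : ℝ) (n : ℕ) : Continuous (chirpApprox a n) := by
  unfold chirpApprox
  fun_prop

lemma norm_chirpApprox (a : ℝ) (n : ℕ) (x : ℝ) :
    ‖chirpApprox a n x‖ = Real.exp (-(1 / ((n : ℝ) + 1)) * x ^ 2) := by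
  rw [chirpApprox, Complex.norm_exp]
  congr 1
  rw [← Complex.ofReal_pow, Complex.re_mul_ofReal, Complex.neg_re, Complex.sub_re,
    Complex.ofReal_re]
  simp only [Complex.mul_re, Complex.I_re, Complex.I_im, Complex.ofReal_im, zero_mul, mul_zero,
    sub_zero]

lemma norm_chirpApprox_le (a : ℝ) (n : ℕ) (x : ℝ) : ‖chirpApprox a n x‖ ≤ 1 := by
  rw [norm_chirpApprox, Real.exp_le_one_iff]
  have : 0 < 1 / ((n : ℝ) + 1) := by positivity
  nlinarith [sq_nonneg x]

lemma integrable_chirpApprox (a : ℝ) (n : ℕ) : Integrable (chirpApprox a n) := by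
  refine (integrable_exp_neg_mul_sq (b := 1 / ((n : ℝ) + 1)) (by positivity)).mono
    (continuous_chirpApprox a n).aestronglyMeasurable (Eventually.of_forall fun x => ?_)
  rw [norm_chirpApprox, Real.norm_eq_abs, Real.abs_exp]

lemma memLp_chirpApprox (a : ℝ) (n : ℕ) : MemLp (chirpApprox a n) 2 volume := by
  rw [memLp_two_iff_integrable_sq_norm (continuous_chirpApprox a n).aestronglyMeasurable]
  refine (integrable_exp_neg_mul_sq (b := 2 * (1 / ((n : ℝ) + 1))) (by positivity)).congr
    (Eventually.of_forall fun x => ?_)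
  simp only
  rw [norm_chirpApprox, ← Real.exp_nat_mul]
  congr 1
  push_cast
  ring

lemma tendsto_chirpApprox (a x : ℝ) : Tendsto (fun n => chirpApprox a n x) atTop
    (𝓝 (Complex.exp (Complex.I * (a * x ^ 2 : ℝ)))) := by
  have h : Tendsto (fun n : ℕ => -((1 / ((n : ℝ) + 1) : ℝ) - Complex.I * a) * (x : ℂ) ^ 2) atTop
      (𝓝 (-(((0:ℝ) : ℂ) - Complex.I * a) * (x : ℂ) ^ 2)) :=
    (((Complex.continuous_ofReal.tendsto _).comp
      tendsto_one_div_add_atTop_nhds_zero_nat).sub_const _).neg.mul_const _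
  have h2 := (Complex.continuous_exp.tendsto _).comp h
  convert! h2 using 2
  congr 1
  push_cast
  ring

/-- Fourier transform of a regularised chirp times an inverse Fourier transform. -/
lemma IsFourier.chirpApprox_apply {F : L2 ≃ₗᵢ[ℂ] L2} (hF : IsFourier F) (a : ℝ) (n : ℕ)
    {A : L2 →L[ℂ] L2} (hA : IsMulOp (chirpApprox a n) A) {g : L2} (hg : Integrable (⇑g) volume) :
    (F (A (F.symm g)) : ℝ → ℂ) =ᵐ[volume] fun p =>
      (((2 * π) ^ (-(1:ℝ)/2) : ℝ) : ℂ) ^ 2 *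
        ((π / (((1 / ((n : ℝ) + 1) : ℝ) : ℂ) - Complex.I * a)) ^ (1 / 2 : ℂ) *
        ∫ k : ℝ, Complex.exp (-((k - p : ℝ) : ℂ) ^ 2 /
          (4 * (((1 / ((n : ℝ) + 1) : ℝ) : ℂ) - Complex.I * a))) * g k) := by
  have hint : Integrable (⇑(A (F.symm g))) volume :=
    ((memLp_chirpApprox a n).integrable_mul (Lp.memLp (F.symm g))).congr (hA (F.symm g)).symm
  refine (hF _ hint).trans (Eventually.of_forall fun p => ?_)
  simp only
  set c : ℂ := (((2 * π) ^ (-(1:ℝ)/2) : ℝ) : ℂ)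
  set b : ℂ := ((1 / ((n : ℝ) + 1) : ℝ) : ℂ) - Complex.I * a with hb
  have h1 : ∫ x : ℝ, Complex.exp (-Complex.I * p * x) * A (F.symm g) x =
      ∫ x : ℝ, ∫ k : ℝ, c *
        (Complex.exp (Complex.I * (k - p : ℝ) * x) * Complex.exp (-b * x ^ 2) * g k) := by
    refine integral_congr_ae ?_
    filter_upwards [hA (F.symm g), hF.symm_apply_ae hg] with x hx hx'
    rw [hx, hx', mul_left_comm (chirpApprox a n x), mul_left_comm, ← integral_const_mul,
      ← integral_const_mul, ← integral_const_mul]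
    congr 1
    ext k
    congr 1
    rw [← mul_assoc, ← mul_assoc, chirpApprox, ← Complex.exp_add, ← Complex.exp_add,
      ← Complex.exp_add]
    congr 2
    rw [hb]
    push_cast
    ring
  rw [h1, integral_integral_swap]
  · rw [sq, mul_assoc]
    congr 1
    rw [← integral_const_mul (_ ^ (1 / 2 : ℂ)), ← integral_const_mul c]
    congr 1
    ext k
    rw [integral_const_mul, integral_mul_const,
      fourierIntegral_gaussian (chirpApprox_re_pos a n), ← mul_assoc (_ ^ (1 / 2 : ℂ))]
  · have hprod : Integrable (fun z : ℝ × ℝ => chirpApprox a n z.1 * g z.2)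
        (volume.prod volume) := (integrable_chirpApprox a n).mul_prod hg
    refine (hprod.bdd_mul (f := fun z : ℝ × ℝ => c * Complex.exp (Complex.I * (z.2 - p : ℝ) * z.1))
      (c := ‖c‖) (Continuous.aestronglyMeasurable (by fun_prop))
      (Eventually.of_forall fun z => ?_)).congr (Eventually.of_forall fun z => ?_)
    · have := norm_cexp_I_mul_ofReal ((z.2 - p) * z.1)
      rw [Complex.ofReal_mul, ← mul_assoc] at this
      rw [norm_mul, this, mul_one]
    · simp only [Function.uncurry, chirpApprox, ← hb]
      ring

lemma quasiMeasurePreserving_neg_div {r : ℝ} (hr : r ≠ 0) :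
    Measure.QuasiMeasurePreserving (fun x : ℝ => -x / r) volume volume := by
  refine ⟨by fun_prop, ?_⟩
  have : (fun x : ℝ => -x / r) = fun x => (-r⁻¹) * x := by ext x; field_simp
  rw [this, Real.map_volume_mul_left (by simpa using hr)]
  exact Measure.smul_absolutelyContinuous

/-- The chirp–Fourier–chirp factorisation of convolution with a chirp. -/
lemma IsFourier.chirp_apply {F : L2 ≃ₗᵢ[ℂ] L2} (hF : IsFourier F) {a : ℝ} (ha : 0 < a) :
    ∃ c : ℂ, ∀ f : L2,
      (F (phaseL2 (fun x => a * x ^ 2) (by fun_prop)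
        (F.symm (phaseL2 (fun x => x ^ 2 / (4 * a)) (by fun_prop) (F.symm f)))) : ℝ → ℂ)
      =ᵐ[volume] fun p =>
        (c * conj (Complex.exp (Complex.I * (p ^ 2 / (4 * a) : ℝ)))) * f (-p / (2 * a)) := by
  set c₀ : ℂ := (((2 * π) ^ (-(1:ℝ)/2) : ℝ) : ℂ) with hc₀
  set d : ℂ := (π / (-(Complex.I * a))) ^ (1 / 2 : ℂ) with hd
  refine ⟨c₀ * d, fun f => ?_⟩
  obtain ⟨u, hu, hulim⟩ := exists_seq_integrable (F.symm f)
  have hu1 : Tendsto (fun n => F (u n)) atTop (𝓝 f) := by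
    simpa [Function.comp_def] using (F.continuous.tendsto _).comp hulim
  set T : L2 → L2 := fun w => F (phaseL2 (fun x => a * x ^ 2) (by fun_prop)
        (F.symm (phaseL2 (fun x => x ^ 2 / (4 * a)) (by fun_prop) w))) with hT
  have hTc : Continuous T := by fun_prop
  refine ae_eq_of_tendsto hu1 (v := fun n => T (u n)) ((hTc.tendsto _).comp hulim)
    (quasiMeasurePreserving_neg_div (by positivity)) fun m => ?_
  set g := u m
  set ηg : L2 := phaseL2 (fun x => x ^ 2 / (4 * a)) (by fun_prop) g with hηg
  have hg : Integrable (⇑g) volume := hu m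
  have hgi : Integrable (⇑ηg) volume := integrable_phaseL2 _ hg
  set A : ℕ → L2 →L[ℂ] L2 := fun n => mulL2 (chirpApprox a n)
    (continuous_chirpApprox a n).measurable (norm_chirpApprox_le a n)
  have hA : ∀ n, IsMulOp (chirpApprox a n) (A n) := fun n => isMulOp_mulL2 _ _
  have hlim : Tendsto (fun n => F (A n (F.symm ηg))) atTop (𝓝 (T g)) := by
    refine (F.continuous.tendsto _).comp ?_
    exact tendsto_mulOp hA (isMulOp_mulL2 _ _) (fun n => (continuous_chirpApprox a n).measurable)
      (by fun_prop) (norm_chirpApprox_le a) (fun x => (norm_cexp_I_mul_ofReal _).le)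
      (tendsto_chirpApprox a) _
  obtain ⟨ns, hns, hae⟩ := exists_subseq_tendsto_ae hlim
  have hF' := (quasiMeasurePreserving_neg_div (r := 2 * a) (by positivity)).ae (hF g hg)
  filter_upwards [hae, hF', ae_all_iff.2 fun n => hF.chirpApprox_apply a n (hA n) hgi]
    with p h1 h2 h3
  refine tendsto_nhds_unique h1 ?_
  simp_rw [h3, ← hc₀]
  rw [h2]
  have hb : Tendsto (fun n : ℕ => ((1 / ((n : ℝ) + 1) : ℝ) : ℂ) - Complex.I * a) atTop
      (𝓝 (-(Complex.I * a))) := by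
    have := ((Complex.continuous_ofReal.tendsto _).comp
      tendsto_one_div_add_atTop_nhds_zero_nat).sub_const (Complex.I * a)
    simpa using this
  have ha' : (a : ℂ) ≠ 0 := by exact_mod_cast ha.ne'
  have hne : -(Complex.I * a) ≠ 0 := by simp [ha']
  have hlim1 : Tendsto (fun n : ℕ =>
      (π / (((1 / ((n : ℝ) + 1) : ℝ) : ℂ) - Complex.I * a)) ^ (1 / 2 : ℂ)) atTop (𝓝 d) := by
    refine (tendsto_const_nhds.div hb hne).cpow tendsto_const_nhds ?_
    right
    have : (π : ℂ) / -(Complex.I * a) = ((π / a : ℝ) : ℂ) * Complex.I := by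
      push_cast
      field_simp
      rw [Complex.I_sq]
    rw [this]
    simp
    positivity
  have hlim2 : Tendsto (fun n : ℕ => ∫ k : ℝ, Complex.exp (-((k - p : ℝ) : ℂ) ^ 2 /
      (4 * (((1 / ((n : ℝ) + 1) : ℝ) : ℂ) - Complex.I * a))) * ηg k) atTop
      (𝓝 (∫ k : ℝ, Complex.exp (-((k - p : ℝ) : ℂ) ^ 2 / (4 * -(Complex.I * a))) * ηg k)) := by
    refine tendsto_integral_of_dominated_convergence (fun k => ‖ηg k‖) (fun n => ?_) hgi.norm
      (fun n => Eventually.of_forall fun k => ?_) (Eventually.of_forall fun k => ?_)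
    · exact (Continuous.aestronglyMeasurable (by fun_prop)).mul (Lp.aestronglyMeasurable _)
    · rw [norm_mul, Complex.norm_exp]
      refine mul_le_of_le_one_left (norm_nonneg _) (Real.exp_le_one_iff.2 ?_)
      set b := ((1 / ((n : ℝ) + 1) : ℝ) : ℂ) - Complex.I * a with hb
      have hbre : 0 < b.re := chirpApprox_re_pos a n
      have : -((k - p : ℝ) : ℂ) ^ 2 / (4 * b) = ((-((k - p) ^ 2 / 4) : ℝ) : ℂ) * b⁻¹ := by
        push_cast
        rw [div_eq_mul_inv, mul_inv]
        ring
      rw [this, Complex.re_ofReal_mul, Complex.inv_re]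
      exact mul_nonpos_of_nonpos_of_nonneg (by nlinarith [sq_nonneg (k - p)])
        (div_nonneg hbre.le (Complex.normSq_nonneg _))
    · refine Tendsto.mul_const _ ((Complex.continuous_exp.tendsto _).comp ?_)
      exact tendsto_const_nhds.div (hb.const_mul 4) (by simpa using hne)
  have key : ∫ k : ℝ, Complex.exp (-((k - p : ℝ) : ℂ) ^ 2 / (4 * -(Complex.I * a))) * ηg k =
      conj (Complex.exp (Complex.I * (p ^ 2 / (4 * a) : ℝ))) *
        ∫ k : ℝ, Complex.exp (-Complex.I * (-p / (2 * a) : ℝ) * k) * g k := by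
    rw [← integral_const_mul]
    refine integral_congr_ae ?_
    filter_upwards [coeFn_phaseL2 (θ := fun x => x ^ 2 / (4 * a)) (by fun_prop) g] with k hk
    rw [hηg, hk, ← mul_assoc, ← mul_assoc, exp_neg_sq_div_mul ha.ne']
  have := ((hlim1.mul hlim2).const_mul (c₀ ^ 2)).comp hns.tendsto_atTop
  rw [key] at this
  convert! this using 2
  ring

lemma Real.measurable_sign : Measurable Real.sign := by
  unfold Real.sign
  exact Measurable.ite measurableSet_Iio measurable_const
    (Measurable.ite measurableSet_Ioi measurable_const measurable_const)

lemma Real.abs_sign_le_one (x : ℝ) : |Real.sign x| ≤ 1 := by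
  rcases Real.sign_apply_eq x with h | h | h <;> simp [h]

lemma Real.sign_neg_div {r : ℝ} (hr : 0 < r) (x : ℝ) : Real.sign (-x / r) = -Real.sign x := by
  rcases lt_trichotomy x 0 with h | rfl | h
  · rw [Real.sign_of_neg h, Real.sign_of_pos (div_pos (neg_pos.2 h) hr), neg_neg]
  · simp
  · rw [Real.sign_of_pos h, Real.sign_of_neg (div_neg_of_neg_of_pos (neg_lt_zero.2 h) hr)]

/-- Multiplication by the sign function. -/
def sgnL2 : L2 →L[ℂ] L2 :=
  mulL2 (fun q => ((Real.sign q : ℝ) : ℂ)) (by have := Real.measurable_sign; fun_prop) fun x => by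
    rw [Complex.norm_real, Real.norm_eq_abs]
    exact Real.abs_sign_le_one x

lemma isMulOp_sgnL2 : IsMulOp (fun q => ((Real.sign q : ℝ) : ℂ)) sgnL2 := isMulOp_mulL2 _ _

lemma sgnL2_sgnL2 (ψ : L2) : sgnL2 (sgnL2 ψ) = ψ := by
  refine Lp.ext ?_
  filter_upwards [isMulOp_sgnL2 (sgnL2 ψ), isMulOp_sgnL2 ψ,
    Measure.ae_ne volume (0 : ℝ)] with x h1 h2 hx
  rw [h1, h2]
  rcases hx.lt_or_gt with h | h
  · simp [Real.sign_of_neg h]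
  · simp [Real.sign_of_pos h]

lemma inner_sgnL2_left (u v : L2) : ⟪sgnL2 u, v⟫_ℂ = ⟪u, sgnL2 v⟫_ℂ :=
  isMulOp_sgnL2.inner_left (isMulOp_sgnL2.congr (by simp)) u v

/-- Multiplication by `exp (i k x²)`. -/
def quadPhase (k : ℝ) : L2 →L[ℂ] L2 := phaseL2 (fun x => k * x ^ 2) (by fun_prop)

lemma isMulOp_quadPhase (k : ℝ) :
    IsMulOp (fun x => Complex.exp (Complex.I * (k * x ^ 2 : ℝ))) (quadPhase k) :=
  coeFn_phaseL2 _

lemma quadPhase_quadPhase (j k : ℝ) (ψ : L2) :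
    quadPhase j (quadPhase k ψ) = quadPhase (j + k) ψ := by
  refine Lp.ext ?_
  filter_upwards [isMulOp_quadPhase j (quadPhase k ψ), isMulOp_quadPhase k ψ,
    isMulOp_quadPhase (j + k) ψ] with x h1 h2 h3
  rw [h1, h2, h3, ← mul_assoc, ← Complex.exp_add]
  congr 2
  push_cast
  ring

lemma quadPhase_zero (ψ : L2) : quadPhase 0 ψ = ψ := by
  refine Lp.ext ?_
  filter_upwards [isMulOp_quadPhase 0 ψ] with x h1
  simp [h1]

lemma quadPhase_neg_quadPhase (k : ℝ) (ψ : L2) : quadPhase (-k) (quadPhase k ψ) = ψ := by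
  rw [quadPhase_quadPhase, neg_add_cancel, quadPhase_zero]

lemma quadPhase_quadPhase_neg (k : ℝ) (ψ : L2) : quadPhase k (quadPhase (-k) ψ) = ψ := by
  rw [quadPhase_quadPhase, add_neg_cancel, quadPhase_zero]

lemma sgnL2_quadPhase (k : ℝ) (ψ : L2) : sgnL2 (quadPhase k ψ) = quadPhase k (sgnL2 ψ) := by
  refine Lp.ext ?_
  filter_upwards [isMulOp_quadPhase k ψ, isMulOp_quadPhase k (sgnL2 ψ), isMulOp_sgnL2 ψ,
    isMulOp_sgnL2 (quadPhase k ψ)] with x h1 h2 h3 h4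
  rw [h4, h1, h2, h3, mul_left_comm]

lemma inner_quadPhase (k : ℝ) (u v : L2) : ⟪quadPhase k u, quadPhase k v⟫_ℂ = ⟪u, v⟫_ℂ := by
  rw [(isMulOp_quadPhase k).inner_left ((isMulOp_quadPhase (-k)).congr ?_),
    quadPhase_neg_quadPhase]
  ext x
  rw [← Complex.exp_conj]
  congr 1
  rw [map_mul, Complex.conj_I, Complex.conj_ofReal]
  push_cast
  ring

/-- Conjugation of the sign multiplication operator by a unitary. -/
def conjSgn (F : L2 ≃ₗᵢ[ℂ] L2) (ψ : L2) : L2 := F.symm (sgnL2 (F ψ))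

lemma conjSgn_neg (F : L2 ≃ₗᵢ[ℂ] L2) (ψ : L2) : conjSgn F (-ψ) = -conjSgn F ψ := by
  simp [conjSgn]

lemma conjSgn_conjSgn (F : L2 ≃ₗᵢ[ℂ] L2) (ψ : L2) : conjSgn F (conjSgn F ψ) = ψ := by
  simp [conjSgn, sgnL2_sgnL2]

lemma IsFourier.chirp_anticommute {F : L2 ≃ₗᵢ[ℂ] L2} (hF : IsFourier F) {a : ℝ} (ha : 0 < a)
    (f : L2) :
    F (quadPhase a (F.symm (quadPhase (1 / (4 * a)) (F.symm (sgnL2 f))))) =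
      -sgnL2 (F (quadPhase a (F.symm (quadPhase (1 / (4 * a)) (F.symm f))))) := by
  obtain ⟨c, hc⟩ := hF.chirp_apply ha
  have hphase : phaseL2 (fun x => x ^ 2 / (4 * a)) (by fun_prop) = quadPhase (1 / (4 * a)) := by
    unfold quadPhase
    congr 1
    ext x
    ring
  rw [hphase] at hc
  change ∀ f : L2, (F (quadPhase a (F.symm (quadPhase (1 / (4 * a)) (F.symm f)))) : ℝ → ℂ)
    =ᵐ[volume] _ at hc
  refine Lp.ext ?_
  filter_upwards [hc f, hc (sgnL2 f), Lp.coeFn_neg (sgnL2 (F (quadPhase a (F.symm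
    (quadPhase (1 / (4 * a)) (F.symm f)))))), isMulOp_sgnL2 (F (quadPhase a (F.symm
    (quadPhase (1 / (4 * a)) (F.symm f))))),
    (quasiMeasurePreserving_neg_div (r := 2 * a) (by positivity)).ae (isMulOp_sgnL2 f)]
    with p h1 h2 h3 h4 h5
  rw [h2, h3, Pi.neg_apply, h4, h1, h5, Real.sign_neg_div (by positivity)]
  push_cast
  ring

lemma IsSgnP.exists_fourier {T : L2 →L[ℂ] L2} (h : IsSgnP T) :
    ∃ F, IsFourier F ∧ ∀ ψ, T ψ = conjSgn F ψ := by
  obtain ⟨F, hF, hT⟩ := h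
  refine ⟨F, hF, fun ψ => ?_⟩
  rw [conjSgn, LinearIsometryEquiv.eq_symm_apply]
  exact Lp.ext ((hT ψ).trans (isMulOp_sgnL2 (F ψ)).symm)

lemma chi_eq {t b : ℝ} (h : Real.cos t / Real.sin t = -(2 * b)) :
    chi t = fun x => Complex.exp (Complex.I * (b * x ^ 2 : ℝ)) := by
  ext x
  rw [chi, h]
  congr 1
  push_cast
  ring

lemma IsSgnQ.exists_fourier {t b : ℝ} {T : L2 →L[ℂ] L2} (h : IsSgnQ t T) (ht : t ≠ 0)
    (hb : Real.cos t / Real.sin t = -(2 * b)) :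
    ∃ F, IsFourier F ∧ ∀ ψ, T ψ = ((Real.sign (Real.sin t) : ℝ) : ℂ) •
      quadPhase b (conjSgn F (quadPhase (-b) ψ)) := by
  rw [IsSgnQ, if_neg ht] at h
  obtain ⟨P, Mc, Mci, hP, hMc, hMci, rfl⟩ := h
  obtain ⟨F, hF, hPF⟩ := hP.exists_fourier
  refine ⟨F, hF, fun ψ => ?_⟩
  have h1 : Mc = quadPhase b := hMc.unique ((isMulOp_quadPhase b).congr (chi_eq hb).symm)
  have h2 : Mci = quadPhase (-b) := by
    refine hMci.unique ((isMulOp_quadPhase (-b)).congr ?_)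
    ext x
    rw [chi_eq hb, ← Complex.exp_neg]
    congr 1
    push_cast
    ring
  simp only [h1, h2, _root_.smul_apply, ContinuousLinearMap.comp_apply, hPF]

lemma sin_two_pi_div_three : Real.sin (2 * π / 3) = √3 / 2 := by
  rw [show 2 * π / 3 = π - π / 3 by ring, Real.sin_pi_sub, Real.sin_pi_div_three]

lemma cos_two_pi_div_three : Real.cos (2 * π / 3) = -(1 / 2) := by
  rw [show 2 * π / 3 = π - π / 3 by ring, Real.cos_pi_sub, Real.cos_pi_div_three]

lemma sin_four_pi_div_three : Real.sin (4 * π / 3) = -(√3 / 2) := by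
  rw [show 4 * π / 3 = π / 3 + π by ring, Real.sin_add_pi, Real.sin_pi_div_three]

lemma cos_four_pi_div_three : Real.cos (4 * π / 3) = -(1 / 2) := by
  rw [show 4 * π / 3 = π / 3 + π by ring, Real.cos_add_pi, Real.cos_pi_div_three]

/-- Simultaneous normal forms of the three sign operators. -/
lemma exists_normal_forms {A0 A2 A4 : L2 →L[ℂ] L2}
    (h0 : IsSgnQ 0 A0) (h2 : IsSgnQ (2 * π / 3) A2) (h4 : IsSgnQ (4 * π / 3) A4) :
    ∃ F, IsFourier F ∧ A0 = sgnL2 ∧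
      (∀ ψ, A2 ψ = quadPhase (1 / (2 * √3)) (conjSgn F (quadPhase (-(1 / (2 * √3))) ψ))) ∧
      ∀ ψ, A4 ψ = -quadPhase (-(1 / (2 * √3))) (conjSgn F (quadPhase (1 / (2 * √3)) ψ)) := by
  have h3 : (0 : ℝ) < √3 := by positivity
  obtain ⟨F, hF, e2⟩ := h2.exists_fourier (b := 1 / (2 * √3)) (by positivity) (by
    rw [sin_two_pi_div_three, cos_two_pi_div_three]; field_simp)
  obtain ⟨G, hG, e4⟩ := h4.exists_fourier (b := -(1 / (2 * √3))) (by positivity) (by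
    rw [sin_four_pi_div_three, cos_four_pi_div_three]; field_simp)
  obtain rfl := hF.unique hG
  refine ⟨F, hF, ?_, fun ψ => ?_, fun ψ => ?_⟩
  · rw [IsSgnQ, if_pos rfl] at h0
    exact h0.unique isMulOp_sgnL2
  · rw [e2, sin_two_pi_div_three, Real.sign_of_pos (by positivity), Complex.ofReal_one, one_smul]
  · rw [e4, sin_four_pi_div_three, Real.sign_of_neg (by simp), neg_neg]
    simp

/-- The unitary intertwining the pair `(sgn Q(2π/3), sgn Q(4π/3))` with `(sgn Q, sgn P)`. -/
def intertwiner (F : L2 ≃ₗᵢ[ℂ] L2) (ψ : L2) : L2 :=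
  quadPhase (-(√3 / 4)) (F (quadPhase (-(1 / (2 * √3))) ψ))

lemma inner_intertwiner (F : L2 ≃ₗᵢ[ℂ] L2) (u v : L2) :
    ⟪intertwiner F u, intertwiner F v⟫_ℂ = ⟪u, v⟫_ℂ := by
  rw [intertwiner, intertwiner, inner_quadPhase, F.inner_map_map, inner_quadPhase]

lemma intertwiner_sgnL2 (F : L2 ≃ₗᵢ[ℂ] L2) (ψ : L2) :
    intertwiner F (quadPhase (1 / (2 * √3)) (conjSgn F (quadPhase (-(1 / (2 * √3))) ψ))) =
      sgnL2 (intertwiner F ψ) := by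
  rw [intertwiner, quadPhase_neg_quadPhase, conjSgn, F.apply_symm_apply, intertwiner,
    sgnL2_quadPhase]

lemma IsFourier.intertwiner_conjSgn {F : L2 ≃ₗᵢ[ℂ] L2} (hF : IsFourier F) (ψ : L2) :
    intertwiner F (-quadPhase (-(1 / (2 * √3))) (conjSgn F (quadPhase (1 / (2 * √3)) ψ))) =
      conjSgn F (intertwiner F ψ) := by
  have h3 : (0 : ℝ) < √3 := by positivity
  have key := hF.chirp_anticommute (a := 1 / √3) (by positivity) (F (intertwiner F ψ))
  rw [show 1 / (4 * (1 / √3)) = √3 / 4 by field_simp] at key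
  set b := 1 / (2 * √3) with hb
  have hab : 1 / √3 = b + b := by rw [hb]; field_simp; norm_num
  rw [hab] at key
  have e : F.symm (quadPhase (√3 / 4) (F.symm (F (intertwiner F ψ)))) = quadPhase (-b) ψ := by
    rw [F.symm_apply_apply, intertwiner, quadPhase_quadPhase_neg, F.symm_apply_apply]
  rw [e, quadPhase_quadPhase, add_neg_cancel_right] at key
  rw [conjSgn, show sgnL2 (F (quadPhase b ψ)) = -F (quadPhase (b + b) (F.symm (quadPhase (√3 / 4)
    (F.symm (sgnL2 (F (intertwiner F ψ))))))) by rw [key, neg_neg]]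
  rw [map_neg, F.symm_apply_apply, map_neg, neg_neg, intertwiner, ← hb, quadPhase_quadPhase,
    quadPhase_quadPhase, show -b + -b + (b + b) = 0 by ring, quadPhase_zero,
    F.apply_symm_apply, quadPhase_neg_quadPhase, conjSgn]

open scoped FourierTransform SchwartzMap ContDiff

lemma integral_fourier_mul_swap {f g : ℝ → ℂ} (hf : Integrable f) (hg : Integrable g) :
    ∫ x, 𝓕 f x * g x = ∫ x, f x * 𝓕 g x := by
  simpa using! VectorFourier.integral_fourierIntegral_smul_eq_flip (L := innerₗ ℝ)
    Real.continuous_fourierChar continuous_inner hf hg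

lemma integral_fourierInv_mul_swap {f g : ℝ → ℂ} (hf : Integrable f) (hg : Integrable g) :
    ∫ x, 𝓕⁻ f x * g x = ∫ x, f x * 𝓕⁻ g x := by
  have h := VectorFourier.integral_fourierIntegral_smul_eq_flip (L := -innerₗ ℝ)
    Real.continuous_fourierChar continuous_inner.neg hf hg
  rwa [show (-innerₗ ℝ : ℝ →ₗ[ℝ] ℝ →ₗ[ℝ] ℝ).flip = -innerₗ ℝ by ext; simp] at h

/-- Almost everywhere Fourier inversion for integrable functions. -/
lemma fourier_fourierInv_ae_eq {g : ℝ → ℂ} (hg : Integrable g) (hG : Integrable (𝓕⁻ g)) :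
    𝓕 (𝓕⁻ g) =ᵐ[volume] g := by
  have hcont : Continuous (𝓕 (𝓕⁻ g)) :=
    VectorFourier.fourierIntegral_continuous Real.continuous_fourierChar continuous_inner hG
  refine ae_eq_of_integral_contDiff_smul_eq hcont.locallyIntegrable hg.locallyIntegrable
    fun θ hθ hc => ?_
  have hc' : HasCompactSupport fun x => (θ x : ℂ) := hc.comp_left Complex.ofReal_zero
  have hθ' : ContDiff ℝ ∞ fun x => (θ x : ℂ) := Complex.ofRealCLM.contDiff.comp hθ
  let Θ : 𝓢(ℝ, ℂ) := hc'.toSchwartzMap hθ'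
  have hΘ : ∀ x, Θ x = θ x := fun x => rfl
  have h1 := integral_fourier_mul_swap Θ.integrable hG
  have h2 := integral_fourierInv_mul_swap (𝓕 Θ).integrable hg
  rw [← SchwartzMap.fourier_coe] at h1
  rw [← SchwartzMap.fourierInv_coe, FourierTransform.fourierInv_fourier_eq] at h2
  simp only [Complex.real_smul, ← hΘ]
  rw [← h1, h2]

lemma ae_eq_integral_of_integrable_inverse {g G : ℝ → ℂ} (hg : Integrable g) (hG : Integrable G)
    (h : ∀ p, G p = (1 / (2 * (π : ℂ))) *
      ∫ s : ℝ, g s * Complex.exp (Complex.I * (p : ℂ) * (s : ℂ))) :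
    ∀ᵐ s, g s = ∫ p : ℝ, G p * Complex.exp (-Complex.I * p * s) := by
  have hG' : ∀ w, 𝓕⁻ g w = 2 * π * G (2 * π * w) := fun w => by
    rw [h, Real.fourierInv_eq', ← mul_assoc, mul_one_div_cancel (by simp [Real.pi_ne_zero]), one_mul]
    congr 1
    ext s
    rw [smul_eq_mul, mul_comm]
    congr 2
    simp
    ring
  have hGi : Integrable (𝓕⁻ g) := by
    rw [show 𝓕⁻ g = _ from funext hG']
    exact (hG.comp_mul_left' (by positivity)).const_mul _
  filter_upwards [fourier_fourierInv_ae_eq hg hGi] with s hs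
  rw [← hs, Real.fourier_eq']
  have := Measure.integral_comp_mul_left (fun p : ℝ => G p * Complex.exp (-Complex.I * p * s)) (2 * π)
  rw [abs_of_pos (by positivity)] at this
  have h3 := congrArg (fun z => (2 * π : ℝ) • z) this
  simp only [smul_smul] at h3
  rw [mul_inv_cancel₀ (by positivity), one_smul, ← integral_smul] at h3
  rw [← h3]
  congr 1
  ext w
  rw [hG', smul_eq_mul, Complex.real_smul, mul_comm]
  push_cast
  rw [mul_assoc]
  congr 3
  simp
  ring

lemma integrable_inv_Ioc {a : ℝ} (ha : 0 < a) (b : ℝ) :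
    Integrable (fun s : ℝ => s⁻¹) (volume.restrict (Ioc a b)) := by
  have h : ContinuousOn (fun s : ℝ => s⁻¹) (Icc a b) :=
    continuousOn_inv₀.mono fun s hs => (ha.trans_le hs.1).ne'
  exact h.integrableOn_Icc.mono_set Ioc_subset_Icc_self

lemma integral_Ioc_integral_sin_div {w : ℝ → ℂ} (hw : Integrable w) {a b : ℝ} (ha : 0 < a)
    (hab : a ≤ b) :
    ∫ s in Ioc a b, (∫ p : ℝ, w p * (Real.sin (p * s) : ℝ)) / (s : ℂ) =
      ∫ p : ℝ, w p * (Si (p * b) - Si (p * a) : ℝ) := by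
  have h1 : Integrable (fun z : ℝ × ℝ => ((z.1⁻¹ : ℝ) : ℂ) * w z.2)
      ((volume.restrict (Ioc a b)).prod volume) :=
    (integrable_inv_Ioc ha b).ofReal.mul_prod hw
  have h2 : Integrable (fun z : ℝ × ℝ => (Real.sin (z.2 * z.1) : ℂ) * (((z.1⁻¹ : ℝ) : ℂ) * w z.2))
      ((volume.restrict (Ioc a b)).prod volume) := by
    refine h1.bdd_mul (c := 1) (Continuous.aestronglyMeasurable (by fun_prop))
      (Eventually.of_forall fun z => ?_)
    rw [Complex.norm_real]
    exact Real.abs_sin_le_one _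
  calc
    _ = ∫ s in Ioc a b, ∫ p : ℝ, (Real.sin (p * s) : ℂ) * (((s⁻¹ : ℝ) : ℂ) * w p) := by
      congr 1
      ext s
      rw [div_eq_mul_inv, ← integral_mul_const]
      congr 1
      ext p
      push_cast
      ring
    _ = ∫ p : ℝ, ∫ s in Ioc a b, (Real.sin (p * s) : ℂ) * (((s⁻¹ : ℝ) : ℂ) * w p) :=
      integral_integral_swap h2
    _ = _ := by
      congr 1
      ext p
      rw [← integral_sin_mul_div, intervalIntegral.integral_of_le hab, ← integral_complex_ofReal,
        ← integral_const_mul]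
      congr 1
      ext s
      push_cast
      ring

lemma Si_zero : Si 0 = 0 := by simp [Si]

lemma tendsto_Si_mul_atTop (p : ℝ) :
    Tendsto (fun n : ℕ => Si (p * ((n : ℝ) + 1))) atTop (𝓝 (π / 2 * Real.sign p)) := by
  have hn : Tendsto (fun n : ℕ => (n : ℝ) + 1) atTop atTop :=
    tendsto_atTop_add_const_right _ _ tendsto_natCast_atTop_atTop
  rcases lt_trichotomy p 0 with h | rfl | h
  · have h1 := (tendsto_Si_atTop.comp (hn.const_mul_atTop (neg_pos.2 h))).neg
    rw [Real.sign_of_neg h, mul_neg_one]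
    refine h1.congr fun n => ?_
    rw [Function.comp_apply, neg_mul, Si_neg, neg_neg]
  · simp [Si_zero]
  · rw [Real.sign_of_pos h, mul_one]
    exact tendsto_Si_atTop.comp (hn.const_mul_atTop h)

lemma tendsto_Si_mul_inv (p : ℝ) :
    Tendsto (fun n : ℕ => Si (p * (1 / ((n : ℝ) + 1)))) atTop (𝓝 0) := by
  have h := (continuous_Si.tendsto _).comp (tendsto_one_div_add_atTop_nhds_zero_nat.const_mul p)
  rwa [mul_zero, Si_zero] at h

lemma abs_Si_sub_Si_le (x y : ℝ) : |Si x - Si y| ≤ 3 * π := by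
  have := abs_sub (Si x) (Si y)
  linarith [abs_Si_le x, abs_Si_le y]

lemma one_div_succ_le_succ (n : ℕ) : 1 / ((n : ℝ) + 1) ≤ (n : ℝ) + 1 := by
  rw [div_le_iff₀ (by positivity)]
  have : (0 : ℝ) ≤ n := n.cast_nonneg
  nlinarith

lemma integrable_mul_cexp {w : ℝ → ℂ} (hw : Integrable w) (s : ℝ) :
    Integrable fun p : ℝ => w p * Complex.exp (Complex.I * (s * p : ℝ)) := by
  refine hw.mul_bdd (c := 1) (Continuous.aestronglyMeasurable (by fun_prop))
    (Eventually.of_forall fun p => ?_)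
  rw [norm_cexp_I_mul_ofReal]

lemma IsFourier.inner_translL2_eq {F : L2 ≃ₗᵢ[ℂ] L2} (hF : IsFourier F) (u v : L2) (s : ℝ) :
    ⟪u, translL2 s v⟫_ℂ =
      ∫ p : ℝ, conj (F u p) * F v p * Complex.exp (Complex.I * (s * p : ℝ)) := by
  rw [← F.inner_map_map, hF.map_translL2, L2_inner_eq]
  refine integral_congr_ae ?_
  filter_upwards [coeFn_phaseL2 (θ := fun p => s * p) (by fun_prop) (F v)] with p hp
  rw [hp]
  ring

lemma IsFourier.continuous_inner_translL2 {F : L2 ≃ₗᵢ[ℂ] L2} (hF : IsFourier F) (u v : L2) :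
    Continuous fun s => ⟪u, translL2 s v⟫_ℂ := by
  simp only [hF.inner_translL2_eq]
  have hw := L2_integrable_inner (F u) (F v)
  refine continuous_of_dominated (fun s => (integrable_mul_cexp hw s).aestronglyMeasurable)
    (fun s => Eventually.of_forall fun p => ?_) hw.norm
    (Eventually.of_forall fun p => by fun_prop)
  rw [norm_mul, norm_cexp_I_mul_ofReal, mul_one]

lemma IsFourier.integrable_inner_translL2 {F : L2 ≃ₗᵢ[ℂ] L2} (hF : IsFourier F) (u v : L2)
    {a : ℝ} (ha : 0 < a) (b : ℝ) :
    IntegrableOn (fun s : ℝ => (⟪u, translL2 (-s) v⟫_ℂ - ⟪u, translL2 s v⟫_ℂ) / (s : ℂ))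
      (Ioc a b) := by
  have hc := hF.continuous_inner_translL2 u v
  have h : ContinuousOn (fun s : ℝ => (⟪u, translL2 (-s) v⟫_ℂ - ⟪u, translL2 s v⟫_ℂ) / (s : ℂ))
      (Icc a b) :=
    ((hc.comp continuous_neg).sub hc).continuousOn.div Complex.continuous_ofReal.continuousOn
      fun s hs => Complex.ofReal_ne_zero.2 (ha.trans_le hs.1).ne'
  exact h.integrableOn_Icc.mono_set Ioc_subset_Icc_self

/-- The sign of momentum as a principal value integral of translations. -/
lemma IsFourier.tendsto_inner_conjSgn {F : L2 ≃ₗᵢ[ℂ] L2} (hF : IsFourier F) (u v : L2) :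
    Tendsto (fun n : ℕ => (Complex.I / π) * ∫ s in Ioc (1 / ((n : ℝ) + 1)) ((n : ℝ) + 1),
      (⟪u, translL2 (-s) v⟫_ℂ - ⟪u, translL2 s v⟫_ℂ) / (s : ℂ)) atTop
      (𝓝 ⟪u, conjSgn F v⟫_ℂ) := by
  set w : ℝ → ℂ := fun p => conj (F u p) * F v p with hw
  have hwi : Integrable w := L2_integrable_inner _ _
  have hJ := hF.inner_translL2_eq u v
  have hint := fun s => integrable_mul_cexp hwi s
  have hK : ∀ n : ℕ, (Complex.I / π) * ∫ s in Ioc (1 / ((n : ℝ) + 1)) ((n : ℝ) + 1),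
      (⟪u, translL2 (-s) v⟫_ℂ - ⟪u, translL2 s v⟫_ℂ) / (s : ℂ) =
      ∫ p : ℝ, w p * ((2 / π * (Si (p * ((n : ℝ) + 1)) - Si (p * (1 / ((n : ℝ) + 1)))) : ℝ) : ℂ) := by
    intro n
    have h1 : ∀ s : ℝ, (⟪u, translL2 (-s) v⟫_ℂ - ⟪u, translL2 s v⟫_ℂ) / (s : ℂ) =
        (-2 * Complex.I) * ((∫ p : ℝ, w p * (Real.sin (p * s) : ℝ)) / (s : ℂ)) := by
      intro s
      rw [hJ, hJ, ← integral_sub (hint _) (hint _), ← mul_div_assoc, ← integral_const_mul]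
      congr 2
      ext p
      have e1 : Complex.exp (Complex.I * (-s * p : ℝ)) =
          Complex.cos (p * s) - Complex.sin (p * s) * Complex.I := by
        rw [show Complex.I * ((-s * p : ℝ) : ℂ) = (-(p * s)) * Complex.I by push_cast; ring,
          Complex.exp_mul_I, Complex.cos_neg, Complex.sin_neg]
        ring
      have e2 : Complex.exp (Complex.I * (s * p : ℝ)) =
          Complex.cos (p * s) + Complex.sin (p * s) * Complex.I := by
        rw [show Complex.I * ((s * p : ℝ) : ℂ) = (p * s) * Complex.I by push_cast; ring,
          Complex.exp_mul_I]
      rw [e1, e2]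
      push_cast
      ring
    simp only [h1]
    rw [integral_const_mul, integral_Ioc_integral_sin_div hwi (by positivity)
      (one_div_succ_le_succ n), ← mul_assoc, ← integral_const_mul]
    congr 1
    ext p
    have : Complex.I / π * (-2 * Complex.I) = 2 / π := by
      rw [div_mul_eq_mul_div, show Complex.I * (-2 * Complex.I) = -2 * (Complex.I * Complex.I) by ring,
        Complex.I_mul_I]
      ring
    rw [this]
    push_cast
    ring
  simp only [hK]
  have hlim : ⟪u, conjSgn F v⟫_ℂ = ∫ p : ℝ, w p * (Real.sign p : ℝ) := by
    rw [← F.inner_map_map, conjSgn, F.apply_symm_apply, L2_inner_eq]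
    refine integral_congr_ae ?_
    filter_upwards [isMulOp_sgnL2 (F v)] with p hp
    rw [hp, hw]
    ring
  rw [hlim]
  refine tendsto_integral_of_dominated_convergence (fun p => ‖w p‖ * 6) (fun n => ?_)
    (hwi.norm.mul_const _) (fun n => Eventually.of_forall fun p => ?_)
    (Eventually.of_forall fun p => ?_)
  · have := continuous_Si
    exact hwi.aestronglyMeasurable.mul (Continuous.aestronglyMeasurable (by fun_prop))
  · rw [norm_mul, Complex.norm_real, Real.norm_eq_abs, abs_mul, abs_of_pos (by positivity : 0 < 2 / π)]
    refine mul_le_mul_of_nonneg_left ?_ (norm_nonneg _)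
    calc 2 / π * _ ≤ 2 / π * (3 * π) :=
          mul_le_mul_of_nonneg_left (abs_Si_sub_Si_le _ _) (by positivity)
      _ = 6 := by field_simp; norm_num
  · refine Tendsto.const_mul _ ((Complex.continuous_ofReal.tendsto _).comp ?_)
    have h := ((tendsto_Si_mul_atTop p).sub (tendsto_Si_mul_inv p)).const_mul (2 / π)
    rwa [sub_zero, ← mul_assoc, div_mul_div_cancel₀ Real.pi_ne_zero, div_self two_ne_zero, one_mul] at h

/-- The integrand of the Wigner function before the Fourier transform. -/
def wigKer (φ : ℝ → ℂ) (q s : ℝ) : ℂ := φ (q + s / 2) * conj (φ (q - s / 2))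

/-- The sum of the signs at the two arguments of `wigKer`. -/
def signPair (q s : ℝ) : ℝ := Real.sign (q - s / 2) + Real.sign (q + s / 2)

lemma signPair_neg (q s : ℝ) : signPair q (-s) = signPair q s := by
  rw [signPair, signPair, neg_div, sub_neg_eq_add, ← sub_eq_add_neg, add_comm]

lemma signPair_eq {q s : ℝ} (hs : 0 < s) (h : s ≠ 2 * |q|) :
    signPair q s = if s ≤ 2 * |q| then 2 * Real.sign q else 0 := by
  rcases h.lt_or_gt with h1 | h1
  · rw [if_pos h1.le]
    rcases le_total 0 q with hq | hq
    · rw [abs_of_nonneg hq] at h1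
      rw [signPair, Real.sign_of_pos (by linarith), Real.sign_of_pos (by linarith),
        Real.sign_of_pos (by linarith)]
      norm_num
    · rw [abs_of_nonpos hq] at h1
      rw [signPair, Real.sign_of_neg (by linarith), Real.sign_of_neg (by linarith),
        Real.sign_of_neg (by linarith)]
      norm_num
  · rw [if_neg h1.not_ge, signPair, Real.sign_of_neg (by linarith [le_abs_self q]),
      Real.sign_of_pos (by linarith [neg_abs_le q])]
    norm_num

lemma measurable_signPair : Measurable fun z : ℝ × ℝ => signPair z.1 z.2 := by
  have := Real.measurable_sign
  unfold signPair
  fun_prop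

lemma abs_signPair_le (q s : ℝ) : |signPair q s| ≤ 2 := by
  have := abs_add_le (Real.sign (q - s / 2)) (Real.sign (q + s / 2))
  rw [signPair]
  linarith [Real.abs_sign_le_one (q - s / 2), Real.abs_sign_le_one (q + s / 2)]

lemma norm_wigKer_le (φ : ℝ → ℂ) (q s : ℝ) :
    ‖wigKer φ q s‖ ≤ ‖φ (q + s / 2)‖ ^ 2 + ‖φ (q - s / 2)‖ ^ 2 := by
  rw [wigKer, norm_mul, RCLike.norm_conj]
  nlinarith [sq_nonneg (‖φ (q + s / 2)‖ - ‖φ (q - s / 2)‖), sq_nonneg ‖φ (q + s / 2)‖,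
    sq_nonneg ‖φ (q - s / 2)‖]

lemma stronglyMeasurable_wigKer (φ : L2) :
    StronglyMeasurable fun z : ℝ × ℝ => wigKer φ z.1 z.2 := by
  have h := Lp.stronglyMeasurable φ
  refine (h.comp_measurable (g := fun z : ℝ × ℝ => z.1 + z.2 / 2) (by fun_prop)).mul ?_
  exact Complex.continuous_conj.comp_stronglyMeasurable
    (h.comp_measurable (g := fun z : ℝ × ℝ => z.1 - z.2 / 2) (by fun_prop))

lemma integrable_wigKer (φ : L2) (q : ℝ) : Integrable (wigKer φ q) := by
  have ha := L2_integrable_norm_sq φ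
  refine (((ha.comp_add_left q).comp_div two_ne_zero).add
    ((ha.comp_sub_left q).comp_div two_ne_zero)).mono'
    ((stronglyMeasurable_wigKer φ).comp_measurable
      (measurable_prodMk_left (x := q))).aestronglyMeasurable
    (Eventually.of_forall fun s => norm_wigKer_le φ q s)

lemma integrable_prod_shift {a : ℝ → ℝ} (ha : Integrable a) (hm : StronglyMeasurable a) (c : ℝ)
    (μ : Measure ℝ) [IsFiniteMeasure μ] :
    Integrable (fun z : ℝ × ℝ => a (z.1 + c * z.2)) (volume.prod μ) := by
  have hm' : StronglyMeasurable fun z : ℝ × ℝ => a (z.1 + c * z.2) :=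
    hm.comp_measurable (g := fun z : ℝ × ℝ => z.1 + c * z.2) (by fun_prop)
  rw [integrable_prod_iff' hm'.aestronglyMeasurable]
  refine ⟨Eventually.of_forall fun s => ha.comp_add_right (c * s), ?_⟩
  refine (integrable_const (∫ x, ‖a x‖)).congr (Eventually.of_forall fun s => ?_)
  exact (integral_add_right_eq_self (fun x => ‖a x‖) (c * s)).symm

lemma integrable_wigKer_prod (φ : L2) (μ : Measure ℝ) [IsFiniteMeasure μ] :
    Integrable (fun z : ℝ × ℝ => wigKer φ z.1 z.2) (volume.prod μ) := by
  have ha := L2_integrable_norm_sq φ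
  have hm : StronglyMeasurable fun x => ‖φ x‖ ^ 2 := (Lp.stronglyMeasurable φ).norm.pow 2
  refine ((integrable_prod_shift ha hm (1 / 2) μ).add
    (integrable_prod_shift ha hm (-(1 / 2)) μ)).mono'
    (stronglyMeasurable_wigKer φ).aestronglyMeasurable (Eventually.of_forall fun z => ?_)
  refine (norm_wigKer_le φ z.1 z.2).trans_eq ?_
  simp only [Pi.add_apply]
  congr 4 <;> ring

lemma wigKer_neg (φ : ℝ → ℂ) (q s : ℝ) : wigKer φ q (-s) = conj (wigKer φ q s) := by
  simp only [wigKer, map_mul, Complex.conj_conj, neg_div, sub_neg_eq_add, ← sub_eq_add_neg]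
  ring

lemma integrable_signPair_mul (φ : L2) {a b : ℝ} (ha : 0 < a) :
    Integrable (fun z : ℝ × ℝ => ((signPair z.1 z.2 * z.2⁻¹ : ℝ) : ℂ) *
      (wigKer φ z.1 (-z.2) - wigKer φ z.1 z.2))
      (volume.prod (volume.restrict (Ioc a b))) := by
  have h1 := integrable_wigKer_prod φ (volume.restrict (Ioc a b))
  have h2 : Integrable (fun z : ℝ × ℝ => wigKer φ z.1 (-z.2))
      (volume.prod (volume.restrict (Ioc a b))) := by
    simp only [wigKer_neg]
    exact Complex.conjCLE.toContinuousLinearMap.integrable_comp h1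
  have hs := measurable_signPair
  refine (h2.sub h1).bdd_mul (c := 2 * a⁻¹) (Measurable.aestronglyMeasurable (by fun_prop)) ?_
  filter_upwards [(Measure.quasiMeasurePreserving_snd (μ := (volume : Measure ℝ))).ae
    (ae_restrict_mem (μ := volume) (measurableSet_Ioc (a := a) (b := b)))] with z hz
  rw [Complex.norm_real, Real.norm_eq_abs, abs_mul]
  refine mul_le_mul (abs_signPair_le _ _) ?_ (abs_nonneg _) zero_le_two
  rw [abs_of_pos (inv_pos.2 (ha.trans hz.1))]
  exact inv_anti₀ ha hz.1.le

lemma coeFn_translL2 (s : ℝ) (ψ : L2) :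
    (translL2 s ψ : ℝ → ℂ) =ᵐ[volume] fun x => ψ (x + s) :=
  coeFn_compL2 _ ψ

lemma inner_sgnL2_translL2 (φ : L2) (s : ℝ) :
    ⟪sgnL2 φ, translL2 s φ⟫_ℂ + ⟪φ, translL2 s (sgnL2 φ)⟫_ℂ =
      ∫ q, (signPair q s : ℂ) * wigKer φ q s := by
  rw [L2_inner_eq, L2_inner_eq, ← integral_add (L2_integrable_inner _ _) (L2_integrable_inner _ _),
    ← integral_sub_right_eq_self _ (s / 2)]
  refine integral_congr_ae ?_
  have h := (measurePreserving_sub_right (volume : Measure ℝ) (s / 2)).quasiMeasurePreserving.ae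
    ((isMulOp_sgnL2 φ).and ((coeFn_translL2 s φ).and ((coeFn_translL2 s (sgnL2 φ)).and
    ((measurePreserving_add_right (volume : Measure ℝ) s).quasiMeasurePreserving.ae
      (isMulOp_sgnL2 φ)))))
  filter_upwards [h] with q hq
  obtain ⟨h1, h2, h3, h4⟩ := hq
  rw [h1, h2, h3, h4, map_mul, Complex.conj_ofReal, wigKer, signPair,
    show q - s / 2 + s = q + s / 2 by ring]
  push_cast
  ring

/-- The truncation of `Si (2 q p)` to the scales between `a` and `b`. -/
def cutSi (a b q p : ℝ) : ℝ :=
  Real.sign q * (Si (p * max a (min b (2 * |q|))) - Si (p * a))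

lemma abs_cutSi_le (a b q p : ℝ) : |cutSi a b q p| ≤ 3 * π := by
  rw [cutSi, abs_mul]
  exact (mul_le_of_le_one_left (abs_nonneg _) (Real.abs_sign_le_one q)).trans
    (abs_Si_sub_Si_le _ _)

lemma measurable_cutSi (a b : ℝ) : Measurable fun z : ℝ × ℝ => cutSi a b z.1 z.2 := by
  have h1 := Real.measurable_sign
  have h2 := continuous_Si.measurable
  unfold cutSi
  fun_prop

lemma tendsto_cutSi (q p : ℝ) :
    Tendsto (fun n : ℕ => cutSi (1 / ((n : ℝ) + 1)) ((n : ℝ) + 1) q p) atTop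
      (𝓝 (Si (2 * q * p))) := by
  have h1 : Tendsto (fun n : ℕ => min ((n : ℝ) + 1) (2 * |q|)) atTop (𝓝 (2 * |q|)) := by
    refine tendsto_const_nhds.congr' ?_
    filter_upwards [tendsto_natCast_atTop_atTop.eventually_ge_atTop (2 * |q|)] with n hn
    rw [min_eq_right (by linarith)]
  have h2 : Tendsto (fun n : ℕ => max (1 / ((n : ℝ) + 1)) (min ((n : ℝ) + 1) (2 * |q|))) atTop
      (𝓝 (max 0 (2 * |q|))) := tendsto_one_div_add_atTop_nhds_zero_nat.max h1
  rw [max_eq_right (by positivity)] at h2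
  have h3 := ((((continuous_Si.tendsto _).comp (h2.const_mul p)).sub
    (tendsto_Si_mul_inv p)).const_mul (Real.sign q))
  convert! h3 using 2
  rw [sub_zero]
  rcases lt_trichotomy q 0 with h | rfl | h
  · rw [Real.sign_of_neg h, abs_of_neg h, neg_one_mul, ← Si_neg]
    congr 1
    ring
  · simp [Si_zero]
  · rw [Real.sign_of_pos h, abs_of_pos h, one_mul]
    congr 1
    ring

lemma wigKer_eq_integral (φ : L2) {q : ℝ} (hq : Integrable (Wig φ q)) :
    ∀ᵐ s, wigKer φ q s = ∫ p : ℝ, Wig φ q p * Complex.exp (-Complex.I * p * s) :=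
  ae_eq_integral_of_integrable_inverse (integrable_wigKer φ q) hq fun _ => rfl

lemma integrable_mul_cexp' {w : ℝ → ℂ} (hw : Integrable w) (s : ℝ) :
    Integrable fun p : ℝ => w p * Complex.exp (-Complex.I * p * s) := by
  refine (integrable_mul_cexp hw (-s)).congr (Eventually.of_forall fun p => ?_)
  simp only
  congr 2
  push_cast
  ring

lemma wigKer_neg_sub (φ : L2) {q : ℝ} (hq : Integrable (Wig φ q)) :
    ∀ᵐ s : ℝ, wigKer φ q (-s) - wigKer φ q s =
      2 * Complex.I * ∫ p : ℝ, Wig φ q p * (Real.sin (p * s) : ℝ) := by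
  have h := wigKer_eq_integral φ hq
  filter_upwards [h, (Measure.measurePreserving_neg
    (volume : Measure ℝ)).quasiMeasurePreserving.ae h] with s h1 h2
  rw [h1, h2, ← integral_sub (integrable_mul_cexp' hq _) (integrable_mul_cexp' hq _),
    ← integral_const_mul]
  congr 1
  ext p
  have e1 : Complex.exp (-Complex.I * p * (-s : ℝ)) =
      Complex.cos (p * s) + Complex.sin (p * s) * Complex.I := by
    rw [show -Complex.I * p * ((-s : ℝ) : ℂ) = (p * s) * Complex.I by push_cast; ring,
      Complex.exp_mul_I]
  have e2 : Complex.exp (-Complex.I * p * s) =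
      Complex.cos (p * s) - Complex.sin (p * s) * Complex.I := by
    rw [show -Complex.I * p * (s : ℂ) = (-(p * s)) * Complex.I by ring,
      Complex.exp_mul_I, Complex.cos_neg, Complex.sin_neg]
    ring
  rw [e1, e2]
  push_cast
  ring

lemma integral_Ioc_signPair_mul (φ : L2) {q : ℝ} (hq : Integrable (Wig φ q)) {a b : ℝ}
    (ha : 0 < a) :
    ∫ s in Ioc a b, ((signPair q s * s⁻¹ : ℝ) : ℂ) * (wigKer φ q (-s) - wigKer φ q s) =
      4 * Complex.I * ∫ p : ℝ, (cutSi a b q p : ℂ) * Wig φ q p := by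
  have hm : Ioc a b ∩ Iic (2 * |q|) = Ioc a (max a (min b (2 * |q|))) := by
    rw [Ioc_inter_Iic]
    rcases le_total a (min b (2 * |q|)) with h | h
    · rw [max_eq_right h]
    · rw [max_eq_left h, Ioc_self, Ioc_eq_empty (not_lt.2 h)]
  calc
    _ = ∫ s in Ioc a b, (Iic (2 * |q|)).indicator (fun s => (4 * Complex.I * Real.sign q) *
          ((∫ p : ℝ, Wig φ q p * (Real.sin (p * s) : ℝ)) / (s : ℂ))) s := by
      refine integral_congr_ae ?_
      filter_upwards [ae_restrict_of_ae (wigKer_neg_sub φ hq), ae_restrict_mem measurableSet_Ioc,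
        ae_restrict_of_ae (Measure.ae_ne volume (2 * |q|))] with s h1 h2 h3
      rw [h1, signPair_eq (ha.trans h2.1) h3]
      by_cases h : s ≤ 2 * |q|
      · rw [if_pos h, indicator_of_mem (mem_Iic.2 h)]
        push_cast
        ring
      · rw [if_neg h, indicator_of_notMem (by simpa using h)]
        simp
    _ = _ := by
      rw [setIntegral_indicator measurableSet_Iic, hm, integral_const_mul,
        integral_Ioc_integral_sin_div hq ha (le_max_left _ _), mul_assoc (4 * Complex.I),
        ← integral_const_mul]
      congr 2
      ext p
      rw [cutSi]
      push_cast
      ring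

lemma integrable_wigKer_left (φ : L2) (s : ℝ) : Integrable fun q => wigKer φ q s := by
  have ha := L2_integrable_norm_sq φ
  exact ((ha.comp_add_right (s / 2)).add (ha.comp_sub_right (s / 2))).mono'
    ((stronglyMeasurable_wigKer φ).comp_measurable
      (measurable_prodMk_right (y := s))).aestronglyMeasurable
    (Eventually.of_forall fun q => norm_wigKer_le φ q s)

lemma integrable_signPair_wigKer (φ : L2) (s t : ℝ) :
    Integrable fun q => (signPair q s : ℂ) * wigKer φ q t := by
  refine (integrable_wigKer_left φ t).bdd_mul (c := 2) ?_ (Eventually.of_forall fun q => ?_)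
  · have := measurable_signPair.comp (measurable_prodMk_right (y := s))
    exact (Complex.measurable_ofReal.comp this).aestronglyMeasurable
  · rw [Complex.norm_real]
    exact abs_signPair_le q s

lemma integrable_mul_Wig {w : ℝ × ℝ → ℂ} (hw : Integrable w) {B : ℝ × ℝ → ℝ} (hB : Measurable B)
    {c : ℝ} (hc : ∀ z, |B z| ≤ c) : Integrable fun z => (B z : ℂ) * w z :=
  hw.bdd_mul (c := c) (Complex.measurable_ofReal.comp hB).aestronglyMeasurable
    (Eventually.of_forall fun z => by rw [Complex.norm_real]; exact hc z)

/-- The Weyl symbol of the anticommutator of `sgn Q` and `sgn P`. -/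
lemma IsFourier.inner_anticommutator {F : L2 ≃ₗᵢ[ℂ] L2} (hF : IsFourier F) (φ : L2)
    (hW : Integrable fun z : ℝ × ℝ => Wig φ z.1 z.2) :
    ⟪φ, sgnL2 (conjSgn F φ)⟫_ℂ + ⟪φ, conjSgn F (sgnL2 φ)⟫_ℂ =
      ∫ z : ℝ × ℝ, ((-(4 / π) * Si (2 * z.1 * z.2) : ℝ) : ℂ) * Wig φ z.1 z.2 := by
  rw [← inner_sgnL2_left]
  refine tendsto_nhds_unique
    ((hF.tendsto_inner_conjSgn (sgnL2 φ) φ).add (hF.tendsto_inner_conjSgn φ (sgnL2 φ))) ?_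
  have hW' : Integrable (fun z : ℝ × ℝ => Wig φ z.1 z.2) (volume.prod volume) := hW
  have key : ∀ n : ℕ, (Complex.I / π) * (∫ s in Ioc (1 / ((n : ℝ) + 1)) ((n : ℝ) + 1),
        (⟪sgnL2 φ, translL2 (-s) φ⟫_ℂ - ⟪sgnL2 φ, translL2 s φ⟫_ℂ) / (s : ℂ)) +
      (Complex.I / π) * (∫ s in Ioc (1 / ((n : ℝ) + 1)) ((n : ℝ) + 1),
        (⟪φ, translL2 (-s) (sgnL2 φ)⟫_ℂ - ⟪φ, translL2 s (sgnL2 φ)⟫_ℂ) / (s : ℂ)) =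
      ∫ z : ℝ × ℝ, ((-(4 / π) * cutSi (1 / ((n : ℝ) + 1)) ((n : ℝ) + 1) z.1 z.2 : ℝ) : ℂ) *
        Wig φ z.1 z.2 := by
    intro n
    set a : ℝ := 1 / ((n : ℝ) + 1) with ha
    set b : ℝ := (n : ℝ) + 1
    have ha0 : 0 < a := by positivity
    have h1 : ∀ s : ℝ, (⟪sgnL2 φ, translL2 (-s) φ⟫_ℂ - ⟪sgnL2 φ, translL2 s φ⟫_ℂ) / (s : ℂ) +
        (⟪φ, translL2 (-s) (sgnL2 φ)⟫_ℂ - ⟪φ, translL2 s (sgnL2 φ)⟫_ℂ) / (s : ℂ) =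
        ∫ q, ((signPair q s * s⁻¹ : ℝ) : ℂ) * (wigKer φ q (-s) - wigKer φ q s) := by
      intro s
      rw [← add_div, sub_add_sub_comm, inner_sgnL2_translL2, inner_sgnL2_translL2]
      simp only [signPair_neg]
      rw [← integral_sub (integrable_signPair_wigKer _ _ _) (integrable_signPair_wigKer _ _ _),
        div_eq_mul_inv, ← integral_mul_const]
      congr 1
      ext q
      push_cast
      ring
    have hcut := integrable_mul_Wig hW' (measurable_cutSi a b) (fun z => abs_cutSi_le a b z.1 z.2)
    rw [← mul_add, ← integral_add (hF.integrable_inner_translL2 _ _ ha0 b)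
      (hF.integrable_inner_translL2 _ _ ha0 b)]
    simp only [h1]
    rw [← integral_integral_swap (integrable_signPair_mul φ ha0),
      integral_congr_ae (g := fun q => 4 * Complex.I * ∫ p : ℝ, (cutSi a b q p : ℂ) * Wig φ q p),
      integral_const_mul, ← mul_assoc, ← integral_prod _ hcut, ← integral_const_mul]
    · refine integral_congr_ae (Eventually.of_forall fun z => ?_)
      have : Complex.I / π * (4 * Complex.I) = -(4 / π) := by
        rw [div_mul_eq_mul_div, show Complex.I * (4 * Complex.I) = 4 * (Complex.I * Complex.I) by ring,
          Complex.I_mul_I]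
        ring
      simp only [this]
      push_cast
      ring
    · filter_upwards [hW'.prod_right_ae] with q hq
      exact integral_Ioc_signPair_mul φ hq ha0
  simp only [key]
  refine tendsto_integral_of_dominated_convergence (fun z => 12 * ‖Wig φ z.1 z.2‖) (fun n => ?_)
    (hW.norm.const_mul _) (fun n => Eventually.of_forall fun z => ?_)
    (Eventually.of_forall fun z => ?_)
  · have := measurable_cutSi (1 / ((n : ℝ) + 1)) ((n : ℝ) + 1)
    exact (Measurable.aestronglyMeasurable (by fun_prop)).mul hW.aestronglyMeasurable
  · rw [norm_mul, Complex.norm_real, Real.norm_eq_abs, abs_mul, abs_neg,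
      abs_of_pos (by positivity : 0 < 4 / π)]
    refine mul_le_mul_of_nonneg_right ?_ (norm_nonneg _)
    calc 4 / π * _ ≤ 4 / π * (3 * π) :=
          mul_le_mul_of_nonneg_left (abs_cutSi_le _ _ _ _) (by positivity)
      _ = 12 := by field_simp; norm_num
  · exact Tendsto.mul_const _ ((Complex.continuous_ofReal.tendsto _).comp
      ((tendsto_cutSi z.1 z.2).const_mul _))

lemma Wig_congr {u v : ℝ → ℂ} (h : u =ᵐ[volume] v) (q p : ℝ) : Wig u q p = Wig v q p := by
  unfold Wig
  congr 1
  refine integral_congr_ae ?_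
  have h2 : (fun x : ℝ => x / 2) = fun x => (2 : ℝ)⁻¹ * x := by ext x; ring
  have hhalf : Measure.QuasiMeasurePreserving (fun x : ℝ => x / 2) volume volume := by
    refine ⟨by fun_prop, ?_⟩
    rw [h2, Real.map_volume_mul_left (by norm_num)]
    exact Measure.smul_absolutelyContinuous
  filter_upwards [hhalf.ae ((measurePreserving_add_left (volume : Measure ℝ)
      q).quasiMeasurePreserving.ae h), hhalf.ae
      ((measurePreserving_const_sub q).quasiMeasurePreserving.ae h)] with x h1 h2
  rw [h1, h2]

lemma Wig_quadPhase (k : ℝ) (ψ : L2) (q p : ℝ) :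
    Wig (quadPhase k ψ) q p = Wig ψ q (p + 2 * k * q) := by
  rw [Wig_congr (isMulOp_quadPhase k ψ), Wig, Wig]
  congr 2
  ext x
  rw [map_mul, ← Complex.exp_conj, map_mul, Complex.conj_I, Complex.conj_ofReal]
  have : Complex.exp (Complex.I * (p + 2 * k * q : ℝ) * x) =
      Complex.exp (Complex.I * (k * (q + x / 2) ^ 2 : ℝ)) *
        Complex.exp (-Complex.I * (k * (q - x / 2) ^ 2 : ℝ)) * Complex.exp (Complex.I * p * x) := by
    rw [← Complex.exp_add, ← Complex.exp_add]
    congr 1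
    push_cast
    ring
  rw [this]
  ring

lemma Wig_eq_inner_parityL2 (φ : L2) (q p : ℝ) :
    Wig φ q p = (1 / (π : ℂ)) * ⟪φ, parityL2 q p φ⟫_ℂ := by
  have h : ⟪φ, parityL2 q p φ⟫_ℂ = ∫ z : ℝ, conj (φ z) *
      (Complex.exp (Complex.I * (2 * p * (q - z) : ℝ)) * φ (2 * q - z)) := by
    rw [L2_inner_eq]
    refine integral_congr_ae ?_
    filter_upwards [coeFn_parityL2 q p φ] with z hz
    rw [hz]
  rw [h, ← integral_sub_left_eq_self _ volume q]
  have h2 := Measure.integral_comp_mul_left (fun z : ℝ => conj (φ (q - z)) *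
      (Complex.exp (Complex.I * (2 * p * (q - (q - z)) : ℝ)) * φ (2 * q - (q - z)))) (2⁻¹ : ℝ)
  rw [inv_inv, abs_of_pos two_pos, Complex.real_smul] at h2
  have h3 : ∀ X : ℂ, 1 / (π : ℂ) * X = 1 / (2 * (π : ℂ)) * (((2 : ℝ) : ℂ) * X) := fun X => by
    push_cast
    have : (π : ℂ) ≠ 0 := by simp [Real.pi_ne_zero]
    field_simp
  rw [h3, ← h2, Wig]
  congr 2
  ext x
  rw [show q - 2⁻¹ * x = q - x / 2 by ring, show 2 * q - (q - x / 2) = q + x / 2 by ring,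
    show Complex.I * ((2 * p * (q - (q - x / 2)) : ℝ) : ℂ) = Complex.I * p * x by push_cast; ring]
  ring

lemma IsFourier.Wig_apply {F : L2 ≃ₗᵢ[ℂ] L2} (hF : IsFourier F) (φ : L2) (q p : ℝ) :
    Wig (F φ) q p = Wig φ p (-q) := by
  have h := hF.map_parityL2 p (-q) φ
  rw [neg_neg] at h
  rw [Wig_eq_inner_parityL2, Wig_eq_inner_parityL2, ← h, F.inner_map_map]

/-- The shear `(q, p) ↦ (q, p + c q)` of phase space. -/
def shear (c : ℝ) : ℝ × ℝ ≃ᵐ ℝ × ℝ where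
  toFun z := (z.1, z.2 + c * z.1)
  invFun z := (z.1, z.2 - c * z.1)
  left_inv z := by simp
  right_inv z := by simp
  measurable_toFun := by simp only [Equiv.coe_fn_mk]; fun_prop
  measurable_invFun := by simp only [Equiv.coe_fn_symm_mk]; fun_prop

lemma shear_apply (c q p : ℝ) : shear c (q, p) = (q, p + c * q) := rfl

lemma measurePreserving_shear (c : ℝ) : MeasurePreserving (shear c) volume volume :=
  (MeasurePreserving.id (volume : Measure ℝ)).skew_product
    (g := fun q p => p + c * q) (by fun_prop)
    (Eventually.of_forall fun q => (measurePreserving_add_right (volume : Measure ℝ) (c * q)).map_eq)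

/-- The rotation `(q, p) ↦ (p, -q)` of phase space. -/
def quarterTurn : ℝ × ℝ ≃ᵐ ℝ × ℝ :=
  MeasurableEquiv.prodComm.trans
    (MeasurableEquiv.prodCongr (MeasurableEquiv.refl ℝ) (MeasurableEquiv.neg ℝ))

lemma quarterTurn_apply (q p : ℝ) : quarterTurn (q, p) = (p, -q) := rfl

lemma measurePreserving_quarterTurn : MeasurePreserving quarterTurn volume volume :=
  ((MeasurePreserving.id (volume : Measure ℝ)).prod
    (Measure.measurePreserving_neg (volume : Measure ℝ))).comp Measure.measurePreserving_swap

/-- Transport of the symbol of the anticommutator along a measure preserving map. -/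
lemma IsFourier.inner_anticommutator_of_covariant {F : L2 ≃ₗᵢ[ℂ] L2} (hF : IsFourier F)
    {e : ℝ × ℝ ≃ᵐ ℝ × ℝ} (he : MeasurePreserving e volume volume) {ψ φ : L2}
    (hW : Integrable fun z : ℝ × ℝ => Wig ψ z.1 z.2)
    (hφ : ∀ q p, Wig φ q p = Wig ψ (e (q, p)).1 (e (q, p)).2) {B : ℝ × ℝ → ℝ}
    (hB : ∀ q p, B (e (q, p)) = -(4 / π) * Si (2 * q * p)) :
    ⟪φ, sgnL2 (conjSgn F φ)⟫_ℂ + ⟪φ, conjSgn F (sgnL2 φ)⟫_ℂ =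
      ∫ z : ℝ × ℝ, (B z : ℂ) * Wig ψ z.1 z.2 := by
  have hφ' : (fun z : ℝ × ℝ => Wig φ z.1 z.2) = (fun z : ℝ × ℝ => Wig ψ z.1 z.2) ∘ e :=
    funext fun z => hφ z.1 z.2
  have hWφ : Integrable fun z : ℝ × ℝ => Wig φ z.1 z.2 := by
    rw [hφ', he.integrable_comp_emb e.measurableEmbedding]
    exact hW
  rw [hF.inner_anticommutator φ hWφ,
    ← he.integral_comp e.measurableEmbedding (fun z : ℝ × ℝ => (B z : ℂ) * Wig ψ z.1 z.2)]
  congr 1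
  ext z
  rw [hφ z.1 z.2, ← hB]

lemma sum_sq_sub_three_apply {A B C : L2 →L[ℂ] L2} (ψ : L2) (hA : ∀ ψ, A (A ψ) = ψ)
    (hB : ∀ ψ, B (B ψ) = ψ) (hC : ∀ ψ, C (C ψ) = ψ) :
    ((A + B + C) ^ 2 - 3 : L2 →L[ℂ] L2) ψ =
      (A (B ψ) + B (A ψ)) + (A (C ψ) + C (A ψ)) + (B (C ψ) + C (B ψ)) := by
  have h3 : (3 : L2 →L[ℂ] L2) ψ = ψ + ψ + ψ := by
    rw [show (3 : L2 →L[ℂ] L2) = 1 + 1 + 1 by norm_num]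
    rfl
  rw [_root_.sub_apply, h3, pow_two]
  change (A + B + C) ((A + B + C) ψ) - _ = _
  simp only [_root_.add_apply, map_add, hA, hB, hC]
  abel

lemma measurable_Si_comp {θ : ℝ × ℝ → ℝ} (hθ : Measurable θ) (c : ℝ) :
    Measurable fun z => c * Si (θ z) :=
  (continuous_Si.measurable.comp hθ).const_mul c

lemma abs_mul_Si_le (x : ℝ) : |4 / π * Si x| ≤ 6 := by
  rw [abs_mul, abs_of_pos (by positivity)]
  calc 4 / π * _ ≤ 4 / π * (3 * π / 2) :=
        mul_le_mul_of_nonneg_left (abs_Si_le _) (by positivity)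
    _ = 6 := by field_simp; norm_num

lemma neg_mul_Si (x : ℝ) : -(4 / π) * Si x = 4 / π * Si (-x) := by
  rw [Si_neg]
  ring

lemma IsFourier.inner_first_pair {F : L2 ≃ₗᵢ[ℂ] L2} (hF : IsFourier F) {A2 : L2 →L[ℂ] L2}
    (hA2 : ∀ ψ, A2 ψ = quadPhase (1 / (2 * √3)) (conjSgn F (quadPhase (-(1 / (2 * √3))) ψ)))
    (ψ : L2) (hW : Integrable fun z : ℝ × ℝ => Wig ψ z.1 z.2) :
    ⟪ψ, sgnL2 (A2 ψ)⟫_ℂ + ⟪ψ, A2 (sgnL2 ψ)⟫_ℂ =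
      ∫ z : ℝ × ℝ, ((4 / π * Si ((4 / √3) * z.1 * ((-z.1 - z.2 * √3) / 2)) : ℝ) : ℂ) *
        Wig ψ z.1 z.2 := by
  have h3 : (0 : ℝ) < √3 := by positivity
  set b := 1 / (2 * √3) with hb
  have h := hF.inner_anticommutator_of_covariant (φ := quadPhase (-b) ψ)
    (B := fun z => 4 / π * Si ((4 / √3) * z.1 * ((-z.1 - z.2 * √3) / 2)))
    (measurePreserving_shear (2 * -b)) hW (fun q p => Wig_quadPhase _ _ _ _) fun q p => by
      rw [neg_mul_Si, shear_apply, hb]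
      congr 2
      field_simp
      ring
  rw [← h, ← inner_quadPhase (-b) ψ, ← inner_quadPhase (-b) ψ, ← sgnL2_quadPhase, hA2, hA2,
    quadPhase_neg_quadPhase, quadPhase_neg_quadPhase, sgnL2_quadPhase (-b) ψ]

lemma IsFourier.inner_second_pair {F : L2 ≃ₗᵢ[ℂ] L2} (hF : IsFourier F) {A4 : L2 →L[ℂ] L2}
    (hA4 : ∀ ψ, A4 ψ = -quadPhase (-(1 / (2 * √3))) (conjSgn F (quadPhase (1 / (2 * √3)) ψ)))
    (ψ : L2) (hW : Integrable fun z : ℝ × ℝ => Wig ψ z.1 z.2) :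
    ⟪ψ, sgnL2 (A4 ψ)⟫_ℂ + ⟪ψ, A4 (sgnL2 ψ)⟫_ℂ =
      ∫ z : ℝ × ℝ, ((4 / π * Si ((4 / √3) * z.1 * ((-z.1 + z.2 * √3) / 2)) : ℝ) : ℂ) *
        Wig ψ z.1 z.2 := by
  have h3 : (0 : ℝ) < √3 := by positivity
  set b := 1 / (2 * √3) with hb
  have h := hF.inner_anticommutator_of_covariant (φ := quadPhase b ψ)
    (B := fun z => -(4 / π) * Si ((4 / √3) * z.1 * ((-z.1 + z.2 * √3) / 2)))
    (measurePreserving_shear (2 * b)) hW (fun q p => Wig_quadPhase _ _ _ _) fun q p => by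
      rw [shear_apply, hb]
      congr 2
      field_simp
      ring
  rw [← neg_inj, neg_add, ← integral_neg]
  simp only [neg_mul, Complex.ofReal_neg] at h ⊢
  rw [← h, ← inner_neg_right, ← inner_neg_right, ← map_neg, hA4, hA4, neg_neg, neg_neg,
    ← inner_quadPhase b ψ, ← inner_quadPhase b ψ, ← sgnL2_quadPhase,
    quadPhase_quadPhase_neg, quadPhase_quadPhase_neg, sgnL2_quadPhase b ψ]

lemma IsFourier.inner_third_pair {F : L2 ≃ₗᵢ[ℂ] L2} (hF : IsFourier F) {A2 A4 : L2 →L[ℂ] L2}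
    (hA2 : ∀ ψ, A2 ψ = quadPhase (1 / (2 * √3)) (conjSgn F (quadPhase (-(1 / (2 * √3))) ψ)))
    (hA4 : ∀ ψ, A4 ψ = -quadPhase (-(1 / (2 * √3))) (conjSgn F (quadPhase (1 / (2 * √3)) ψ)))
    (ψ : L2) (hW : Integrable fun z : ℝ × ℝ => Wig ψ z.1 z.2) :
    ⟪ψ, A2 (A4 ψ)⟫_ℂ + ⟪ψ, A4 (A2 ψ)⟫_ℂ =
      ∫ z : ℝ × ℝ, ((4 / π * Si ((4 / √3) * ((-z.1 + z.2 * √3) / 2) *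
        ((-z.1 - z.2 * √3) / 2)) : ℝ) : ℂ) * Wig ψ z.1 z.2 := by
  have h := hF.inner_anticommutator_of_covariant (φ := intertwiner F ψ)
    (B := fun z => 4 / π * Si ((4 / √3) * ((-z.1 + z.2 * √3) / 2) * ((-z.1 - z.2 * √3) / 2)))
    (e := ((shear (2 * -(√3 / 4))).trans quarterTurn).trans (shear (2 * -(1 / (2 * √3)))))
    (((measurePreserving_shear _).trans measurePreserving_quarterTurn).trans
      (measurePreserving_shear _)) hW
    (fun q p => by
      rw [intertwiner, Wig_quadPhase, hF.Wig_apply, Wig_quadPhase]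
      rfl)
    fun q p => by
      rw [neg_mul_Si]
      simp only [MeasurableEquiv.trans_apply, shear_apply, quarterTurn_apply]
      congr 2
      field_simp
      ring_nf
  rw [← h, ← inner_intertwiner F ψ, ← inner_intertwiner F ψ, hA2 (A4 ψ), intertwiner_sgnL2,
    hA4 ψ, hF.intertwiner_conjSgn, hA4 (A2 ψ), hF.intertwiner_conjSgn, hA2 ψ, intertwiner_sgnL2]

end

/-- With `A := sgn Q(0) + sgn Q(2π/3) + sgn Q(4π/3)`, for every `ψ ∈ L²(ℝ)`
with integrable Wigner function,
`(1/2)⟨ψ, (A² − 3)ψ⟩ = ⟨ψ, (Σ of symmetrized products)ψ⟩ = ∬ f(q,p) W_ψ(q,p) dq dp`;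
i.e. `f` is the Weyl transform of `(A² − 3)/2`. -/
theorem weyl_transform_A_sq (A0 A2 A4 : L2 →L[ℂ] L2)
    (h0 : IsSgnQ 0 A0) (h2 : IsSgnQ (2 * π / 3) A2) (h4 : IsSgnQ (4 * π / 3) A4)
    (ψ : L2) (hW : Integrable (fun qp : ℝ × ℝ => Wig (⇑ψ) qp.1 qp.2) volume) :
    (2 : ℂ)⁻¹ * ⟪ψ, (((A0 + A2 + A4) ^ 2 - 3 : L2 →L[ℂ] L2)) ψ⟫_ℂ =
      ⟪ψ, ((2:ℂ)⁻¹ • (A0 ∘L A2 + A2 ∘L A0) + (2:ℂ)⁻¹ • (A0 ∘L A4 + A4 ∘L A0)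
        + (2:ℂ)⁻¹ • (A2 ∘L A4 + A4 ∘L A2)) ψ⟫_ℂ ∧
    (2 : ℂ)⁻¹ * ⟪ψ, (((A0 + A2 + A4) ^ 2 - 3 : L2 →L[ℂ] L2)) ψ⟫_ℂ =
      ∫ qp : ℝ × ℝ, ((ftrans qp.1 qp.2 : ℝ) : ℂ) * Wig (⇑ψ) qp.1 qp.2 := by
  obtain ⟨F, hF, rfl, hA2, hA4⟩ := exists_normal_forms h0 h2 h4
  have e2 : ∀ φ, A2 (A2 φ) = φ := fun φ => by
    rw [hA2, hA2, quadPhase_neg_quadPhase, conjSgn_conjSgn, quadPhase_quadPhase_neg]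
  have e4 : ∀ φ, A4 (A4 φ) = φ := fun φ => by
    rw [hA4, hA4, map_neg, quadPhase_quadPhase_neg, conjSgn_neg, conjSgn_conjSgn, map_neg, neg_neg,
      quadPhase_neg_quadPhase]
  rw [sum_sq_sub_three_apply ψ sgnL2_sgnL2 e2 e4]
  refine ⟨?_, ?_⟩
  · simp only [_root_.add_apply, _root_.smul_apply, ContinuousLinearMap.comp_apply,
      inner_add_right, inner_smul_right]
    ring
  · have i1 := integrable_mul_Wig hW (measurable_Si_comp (θ := fun z : ℝ × ℝ =>
      (4 / √3) * z.1 * ((-z.1 - z.2 * √3) / 2)) (by fun_prop) (4 / π)) fun z => abs_mul_Si_le _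
    have i2 := integrable_mul_Wig hW (measurable_Si_comp (θ := fun z : ℝ × ℝ =>
      (4 / √3) * z.1 * ((-z.1 + z.2 * √3) / 2)) (by fun_prop) (4 / π)) fun z => abs_mul_Si_le _
    have i3 := integrable_mul_Wig hW (measurable_Si_comp (θ := fun z : ℝ × ℝ =>
      (4 / √3) * ((-z.1 + z.2 * √3) / 2) * ((-z.1 - z.2 * √3) / 2)) (by fun_prop) (4 / π))
      fun z => abs_mul_Si_le _
    simp only [inner_add_right]
    rw [hF.inner_first_pair hA2 ψ hW, hF.inner_second_pair hA4 ψ hW,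
      hF.inner_third_pair hA2 hA4 ψ hW]
    rw [← integral_add i1 i2, ← integral_add (i1.fun_add i2) i3, ← integral_const_mul]
    congr 1
    ext z
    rw [ftrans]
    push_cast
    ring
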